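/- arXiv:1103.5454 — 3 statements merged into one kernel-verified Lean document; each statement's English description precedes it below -/
import Mathlib

section
/- Let F be defined away from {ζ=0} by F = F₀ − (1/β − 1)·log ρ − log( Σ_{m=0}^{n−1} a_m |ζ|^{2βm} + |ζ|^{2−2β} Σ_{m=0}^{n} b_m |ζ|^{2βm} ). Then there exist r > 0 and C > 0 such that at every point of B_r(0) with ζ ≠ 0: Σ_{1≤k,l≤n−1} |∂²F/∂z_k ∂z̄_l| + Σ_{1≤k≤n−1} |ζ|^{1−β}·( |∂²F/∂z_k ∂ζ̄| + |∂²F/∂ζ ∂z̄_k| ) + |ζ|^{2−2β}·|∂²F/∂ζ ∂ζ̄| ≤ C + C·|ζ|^{2−4β}. In particular, since β ∈ (0,1/2), this quantity is uniformly bounded near 0. -/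
/-!
STATEMENT 1: Second-order (∂∂̄) bounds for the Ricci potential
F = F₀ − (1/β − 1)·log ρ − log( Σ_{m=0}^{n−1} a_m |ζ|^{2βm} + |ζ|^{2−2β} Σ_{m=0}^{n} b_m |ζ|^{2βm} )
away from {ζ = 0}:
Σ_{k,l} |∂²F/∂z_k∂z̄_l| + Σ_k |ζ|^{1−β}(|∂²F/∂z_k∂ζ̄| + |∂²F/∂ζ∂z̄_k|)
  + |ζ|^{2−2β}|∂²F/∂ζ∂ζ̄| ≤ C + C|ζ|^{2−4β}.
The paper's dimension n ≥ 1 is rendered as `n + 1`; ζ is the last coordinate, and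
Wirtinger derivatives are defined via the real Fréchet derivative.
-/

noncomputable section

open Complex Metric Finset

/-- Wirtinger derivative ∂f/∂z_i. -/
def wdz {n : ℕ} (i : Fin n) (f : EuclideanSpace ℂ (Fin n) → ℂ)
    (p : EuclideanSpace ℂ (Fin n)) : ℂ :=
  (1/2 : ℂ) * (fderiv ℝ f p (EuclideanSpace.single i 1) -
    Complex.I * fderiv ℝ f p (EuclideanSpace.single i Complex.I))

/-- Wirtinger derivative ∂f/∂z̄_i. -/
def wdzbar {n : ℕ} (i : Fin n) (f : EuclideanSpace ℂ (Fin n) → ℂ)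
    (p : EuclideanSpace ℂ (Fin n)) : ℂ :=
  (1/2 : ℂ) * (fderiv ℝ f p (EuclideanSpace.single i 1) +
    Complex.I * fderiv ℝ f p (EuclideanSpace.single i Complex.I))

section NormRpow

variable {V : Type*} [NormedAddCommGroup V] [InnerProductSpace ℝ V]

theorem hasFDerivAt_norm_rpow_of_ne_zero (γ : ℝ) {z : V} (hz : z ≠ 0) :
    HasFDerivAt (fun z : V => ‖z‖ ^ γ) ((γ * ‖z‖ ^ (γ - 2)) • innerSL ℝ z) z := by
  have hpos : 0 < ‖z‖ := norm_pos_iff.2 hz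
  have h := (hasStrictFDerivAt_norm_sq z).hasFDerivAt.rpow_const (p := γ / 2)
    (Or.inl (pow_ne_zero 2 hpos.ne'))
  have key : ∀ (x : V) (δ : ℝ), (‖x‖ ^ 2) ^ (δ / 2) = ‖x‖ ^ δ := fun x δ => by
    rw [← Real.rpow_natCast, ← Real.rpow_mul (norm_nonneg x)]
    congr 1; push_cast; ring
  simp only [key] at h
  convert h using 1
  rw [show γ / 2 - 1 = (γ - 2) / 2 by ring, key]
  ext v
  simp
  ring

theorem hasFDerivAt_norm_rpow_mul_inner (δ : ℝ) {z : V} (hz : z ≠ 0) (c : V) :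
    HasFDerivAt (fun z : V => ‖z‖ ^ δ * inner ℝ z c)
      (‖z‖ ^ δ • innerSL ℝ c + inner ℝ z c • ((δ * ‖z‖ ^ (δ - 2)) • innerSL ℝ z)) z := by
  have h2 : HasFDerivAt (fun z : V => inner ℝ z c) (innerSL ℝ c) z := by
    simpa [real_inner_comm] using (innerSL ℝ c).hasFDerivAt (x := z)
  exact (hasFDerivAt_norm_rpow_of_ne_zero δ hz).mul h2

theorem abs_norm_rpow_mul_inner_le (δ : ℝ) {z : V} (hz : z ≠ 0) (c : V) :
    |‖z‖ ^ δ * inner ℝ z c| ≤ ‖z‖ ^ (δ + 1) * ‖c‖ := by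
  have hpos : 0 < ‖z‖ := norm_pos_iff.2 hz
  rw [abs_mul, abs_of_nonneg (by positivity), Real.rpow_add_one hpos.ne', mul_assoc]
  gcongr
  exact abs_real_inner_le_norm z c

theorem abs_deriv_norm_rpow_mul_inner_le (δ : ℝ) {z : V} (hz : z ≠ 0) (c d : V) :
    |‖z‖ ^ δ * inner ℝ c d + inner ℝ z c * (δ * ‖z‖ ^ (δ - 2) * inner ℝ z d)|
      ≤ (1 + |δ|) * ‖z‖ ^ δ * ‖c‖ * ‖d‖ := by
  have hpos : 0 < ‖z‖ := norm_pos_iff.2 hz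
  have h1 : |‖z‖ ^ δ * inner ℝ c d| ≤ ‖z‖ ^ δ * (‖c‖ * ‖d‖) := by
    rw [abs_mul, abs_of_nonneg (by positivity)]
    gcongr
    exact abs_real_inner_le_norm c d
  have h2 : |inner ℝ z c * (δ * ‖z‖ ^ (δ - 2) * inner ℝ z d)|
      ≤ (‖z‖ * ‖c‖) * (|δ| * ‖z‖ ^ (δ - 2) * (‖z‖ * ‖d‖)) := by
    rw [abs_mul, abs_mul, abs_mul, abs_of_nonneg (show 0 ≤ ‖z‖ ^ (δ - 2) by positivity)]
    gcongr <;> exact abs_real_inner_le_norm _ _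
  have h3 : ‖z‖ ^ δ = ‖z‖ ^ (δ - 2) * (‖z‖ * ‖z‖) := by
    rw [← pow_two, ← Real.rpow_natCast, ← Real.rpow_add hpos]
    congr 1; push_cast; ring
  refine (abs_add_le _ _).trans ((add_le_add h1 h2).trans (le_of_eq ?_))
  rw [h3]; ring

end NormRpow

section EdgeCoordinates

variable {E V ι : Type*} [NormedAddCommGroup E] [NormedSpace ℝ E]
  [NormedAddCommGroup V] [InnerProductSpace ℝ V]

/-- The map `p ↦ (p, (‖ℓ p‖ ^ γ i)ᵢ)`, through which functions with an edge expansion factor. -/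
def edgeLift (ℓ : E →L[ℝ] V) (γ : ι → ℝ) (p : E) : E × (ι → ℝ) :=
  (p, fun i => ‖ℓ p‖ ^ γ i)

/-- The length of `v` at `p` in the edge metric of cone parameter `β`. -/
def edgeNorm (ℓ : E →L[ℝ] V) (β : ℝ) (p v : E) : ℝ :=
  ‖v‖ + ‖ℓ p‖ ^ (β - 1) * ‖ℓ v‖

theorem edgeNorm_nonneg (ℓ : E →L[ℝ] V) (β : ℝ) (p v : E) : 0 ≤ edgeNorm ℓ β p v := by
  unfold edgeNorm; positivity

theorem norm_le_edgeNorm (ℓ : E →L[ℝ] V) (β : ℝ) (p v : E) : ‖v‖ ≤ edgeNorm ℓ β p v :=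
  le_add_of_nonneg_right (by positivity)

theorem rpow_mul_norm_le_edgeNorm (ℓ : E →L[ℝ] V) (β : ℝ) (p v : E) :
    ‖ℓ p‖ ^ (β - 1) * ‖ℓ v‖ ≤ edgeNorm ℓ β p v :=
  le_add_of_nonneg_left (norm_nonneg v)

theorem continuous_edgeLift (ℓ : E →L[ℝ] V) {γ : ι → ℝ} (hγ : ∀ i, 0 ≤ γ i) :
    Continuous (edgeLift ℓ γ) :=
  continuous_id.prodMk (continuous_pi fun i =>
    (ℓ.continuous.norm).rpow_const fun _ => Or.inr (hγ i))

variable [Fintype ι]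

theorem hasFDerivAt_edgeLift (ℓ : E →L[ℝ] V) (γ : ι → ℝ) {p : E} (hp : ℓ p ≠ 0) :
    HasFDerivAt (edgeLift ℓ γ) ((ContinuousLinearMap.id ℝ E).prod (ContinuousLinearMap.pi
      fun i => ((γ i * ‖ℓ p‖ ^ (γ i - 2)) • innerSL ℝ (ℓ p)).comp ℓ)) p :=
  (hasFDerivAt_id p).prodMk (hasFDerivAt_pi.2 fun i =>
    (hasFDerivAt_norm_rpow_of_ne_zero (γ i) hp).comp p ℓ.hasFDerivAt)

theorem fderiv_edgeLift_apply (ℓ : E →L[ℝ] V) (γ : ι → ℝ) {p : E} (hp : ℓ p ≠ 0) (v : E) :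
    fderiv ℝ (edgeLift ℓ γ) p v =
      (v, fun i => γ i * (‖ℓ p‖ ^ (γ i - 2) * inner ℝ (ℓ p) (ℓ v))) := by
  rw [(hasFDerivAt_edgeLift ℓ γ hp).fderiv]
  ext <;> simp [mul_assoc]

theorem hasFDerivAt_fderiv_edgeLift_apply (ℓ : E →L[ℝ] V) (γ : ι → ℝ) {p : E} (hp : ℓ p ≠ 0)
    (v : E) :
    HasFDerivAt (fun q => fderiv ℝ (edgeLift ℓ γ) q v)
      ((0 : E →L[ℝ] E).prod (ContinuousLinearMap.pi fun i => γ i •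
        (‖ℓ p‖ ^ (γ i - 2) • innerSL ℝ (ℓ v) + inner ℝ (ℓ p) (ℓ v) •
          (((γ i - 2) * ‖ℓ p‖ ^ (γ i - 2 - 2)) • innerSL ℝ (ℓ p))).comp ℓ)) p := by
  have hev : (fun q => fderiv ℝ (edgeLift ℓ γ) q v) =ᶠ[nhds p]
      fun q => (v, fun i => γ i * (‖ℓ q‖ ^ (γ i - 2) * inner ℝ (ℓ q) (ℓ v))) := by
    filter_upwards [ℓ.continuous.continuousAt.eventually_ne hp] with q hq
    exact fderiv_edgeLift_apply ℓ γ hq v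
  refine HasFDerivAt.congr_of_eventuallyEq ?_ hev
  refine (hasFDerivAt_const v p).prodMk (hasFDerivAt_pi.2 fun i => ?_)
  exact ((hasFDerivAt_norm_rpow_mul_inner (γ i - 2) hp (ℓ v)).comp p
    ℓ.hasFDerivAt).const_mul (γ i)

variable {β : ℝ} {γ : ι → ℝ}

theorem exists_norm_fderiv_edgeLift_le (hβ : 0 < β) (hγ : ∀ i, γ i = 0 ∨ 2 * β ≤ γ i)
    (ℓ : E →L[ℝ] V) :
    ∃ K > 0, ∀ p, ℓ p ≠ 0 → ‖ℓ p‖ ≤ 1 → ∀ v,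
      ‖fderiv ℝ (edgeLift ℓ γ) p v‖ ≤ K * edgeNorm ℓ β p v ∧
      ∀ u, ‖fderiv ℝ (fun q => fderiv ℝ (edgeLift ℓ γ) q v) p u‖
        ≤ K * edgeNorm ℓ β p u * edgeNorm ℓ β p v := by
  have hle : ∀ i, |γ i| ≤ ∑ j, |γ j| := fun i =>
    single_le_sum (f := fun j => |γ j|) (fun j _ => abs_nonneg _) (mem_univ i)
  set T := ∑ j, |γ j|
  have hT : 0 ≤ T := sum_nonneg fun j _ => abs_nonneg _
  refine ⟨1 + T * (T + 3), by positivity, fun p hp hp1 v => ⟨?_, fun u => ?_⟩⟩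
  · have hs : 0 < ‖ℓ p‖ := norm_pos_iff.2 hp
    have hN := edgeNorm_nonneg ℓ β p v
    rw [fderiv_edgeLift_apply ℓ γ hp]
    refine max_le ?_ ((pi_norm_le_iff_of_nonneg (by positivity)).2 fun i => ?_)
    · refine (norm_le_edgeNorm ℓ β p v).trans (le_mul_of_one_le_left hN ?_)
      nlinarith
    · rw [Real.norm_eq_abs, abs_mul]
      have h1 := abs_norm_rpow_mul_inner_le (γ i - 2) hp (ℓ v)
      rcases hγ i with h0 | h0
      · rw [h0]; simp; positivity
      have h2 : ‖ℓ p‖ ^ (γ i - 2 + 1) ≤ ‖ℓ p‖ ^ (β - 1) :=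
        Real.rpow_le_rpow_of_exponent_ge hs hp1 (by linarith)
      calc _ ≤ T * (‖ℓ p‖ ^ (β - 1) * ‖ℓ v‖) := by
            gcongr
            · exact hle i
            · exact h1.trans (by gcongr)
        _ ≤ T * edgeNorm ℓ β p v := by
            gcongr; exact rpow_mul_norm_le_edgeNorm ℓ β p v
        _ ≤ _ := by gcongr; nlinarith
  · have hs : 0 < ‖ℓ p‖ := norm_pos_iff.2 hp
    have hNv := edgeNorm_nonneg ℓ β p v
    have hNu := edgeNorm_nonneg ℓ β p u
    rw [(hasFDerivAt_fderiv_edgeLift_apply ℓ γ hp v).fderiv]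
    refine max_le (by simp; positivity)
      ((pi_norm_le_iff_of_nonneg (by positivity)).2 fun i => ?_)
    have h1 := abs_deriv_norm_rpow_mul_inner_le (γ i - 2) hp (ℓ v) (ℓ u)
    have hval : ((((0 : E →L[ℝ] E).prod (ContinuousLinearMap.pi fun i => γ i •
        (‖ℓ p‖ ^ (γ i - 2) • innerSL ℝ (ℓ v) + inner ℝ (ℓ p) (ℓ v) •
          (((γ i - 2) * ‖ℓ p‖ ^ (γ i - 2 - 2)) • innerSL ℝ (ℓ p))).comp ℓ)) u).2 i) =
        γ i * (‖ℓ p‖ ^ (γ i - 2) * inner ℝ (ℓ v) (ℓ u) + inner ℝ (ℓ p) (ℓ v) *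
          ((γ i - 2) * ‖ℓ p‖ ^ (γ i - 2 - 2) * inner ℝ (ℓ p) (ℓ u))) := by
      simp; ring
    rw [hval, Real.norm_eq_abs, abs_mul]
    rcases hγ i with h0 | h0
    · rw [h0]; simp; positivity
    have h2 : ‖ℓ p‖ ^ (γ i - 2) ≤ ‖ℓ p‖ ^ (β - 1) * ‖ℓ p‖ ^ (β - 1) := by
      rw [← Real.rpow_add hs]
      exact Real.rpow_le_rpow_of_exponent_ge hs hp1 (by linarith)
    have h3 : |γ i - 2| ≤ T + 2 :=
      (abs_sub _ _).trans (add_le_add (hle i) (by norm_num))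
    calc _ ≤ T * ((1 + (T + 2)) * (‖ℓ p‖ ^ (β - 1) * ‖ℓ p‖ ^ (β - 1)) * ‖ℓ v‖ * ‖ℓ u‖) := by
          gcongr
          · exact hle i
          · exact h1.trans (by gcongr)
      _ = T * (T + 3) * (‖ℓ p‖ ^ (β - 1) * ‖ℓ u‖) * (‖ℓ p‖ ^ (β - 1) * ‖ℓ v‖) := by ring
      _ ≤ T * (T + 3) * edgeNorm ℓ β p u * edgeNorm ℓ β p v := by
          gcongr <;> exact rpow_mul_norm_le_edgeNorm ℓ β p _
      _ ≤ _ := by gcongr; linarith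

/-- Chain rule bound: a `C²` function of the edge coordinates has bounded edge Hessian. -/
theorem exists_norm_fderiv_fderiv_comp_edgeLift_le {W : Type*} [NormedAddCommGroup W]
    [NormedSpace ℝ W] (hβ : 0 < β) (hγ : ∀ i, γ i = 0 ∨ 2 * β ≤ γ i)
    (ℓ : E →L[ℝ] V) {G : E × (ι → ℝ) → W} (hG : ContDiffAt ℝ 2 G (edgeLift ℓ γ 0)) :
    ∃ C > 0, ∀ᶠ p in nhds (0 : E), ℓ p ≠ 0 → ∀ v,
      DifferentiableAt ℝ (fun q => fderiv ℝ (G ∘ edgeLift ℓ γ) q v) p ∧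
      ∀ u, ‖fderiv ℝ (fun q => fderiv ℝ (G ∘ edgeLift ℓ γ) q v) p u‖
        ≤ C * edgeNorm ℓ β p u * edgeNorm ℓ β p v := by
  obtain ⟨K, hK, hbound⟩ := exists_norm_fderiv_edgeLift_le hβ hγ ℓ
  have hcont : Continuous (edgeLift ℓ γ) := continuous_edgeLift ℓ fun i => by
    rcases hγ i with h | h <;> linarith
  have hG1 : ContDiffAt ℝ 1 (fderiv ℝ G) (edgeLift ℓ γ 0) :=
    hG.fderiv_right (by norm_num)
  have hG2 : ContDiffAt ℝ 0 (fderiv ℝ (fderiv ℝ G)) (edgeLift ℓ γ 0) :=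
    hG1.fderiv_right (by norm_num)
  have hcont3 : ContinuousAt (fun x => ‖fderiv ℝ (fderiv ℝ G) x‖) (edgeLift ℓ γ 0) :=
    ContinuousAt.norm (E := E × (ι → ℝ) →L[ℝ] E × (ι → ℝ) →L[ℝ] W) hG2.continuousAt
  set M := ‖fderiv ℝ G (edgeLift ℓ γ 0)‖ + ‖fderiv ℝ (fderiv ℝ G) (edgeLift ℓ γ 0)‖ + 1
    with hM
  have hMpos : 0 < M := by positivity
  have e1 := hcont.continuousAt.eventually (hG.eventually (by simp))
  have e2 := hcont.continuousAt.eventually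
    (hG1.continuousAt.norm.eventually_lt_const (show ‖fderiv ℝ G (edgeLift ℓ γ 0)‖ < M by
      rw [hM]; linarith [norm_nonneg (fderiv ℝ (fderiv ℝ G) (edgeLift ℓ γ 0))]))
  have e3 := hcont.continuousAt.eventually
    (hcont3.eventually_lt_const (show ‖fderiv ℝ (fderiv ℝ G) (edgeLift ℓ γ 0)‖ < M by
      rw [hM]; linarith [norm_nonneg (fderiv ℝ G (edgeLift ℓ γ 0))]))
  have e4 : ∀ᶠ p in nhds (0 : E), ‖ℓ p‖ < 1 :=
    (ℓ.continuous.norm.continuousAt (x := 0)).eventually_lt_const (by simp)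
  refine ⟨M * K * K + M * K, by positivity, ?_⟩
  filter_upwards [e1.eventually_nhds, e2, e3, e4] with p h1 h2 h3 h4 hp v
  have hev : (fun q => fderiv ℝ (G ∘ edgeLift ℓ γ) q v) =ᶠ[nhds p]
      fun q => fderiv ℝ G (edgeLift ℓ γ q) (fderiv ℝ (edgeLift ℓ γ) q v) := by
    filter_upwards [h1, ℓ.continuous.continuousAt.eventually_ne hp] with q hq hq0
    rw [fderiv_comp q (hq.differentiableAt (by norm_num))
      (hasFDerivAt_edgeLift ℓ γ hq0).differentiableAt]
    rfl
  have hlift := (hasFDerivAt_edgeLift ℓ γ hp).differentiableAt.hasFDerivAt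
  have hlift2 := (hasFDerivAt_fderiv_edgeLift_apply ℓ γ hp v).differentiableAt.hasFDerivAt
  have hdG : HasFDerivAt (fderiv ℝ G) _ (edgeLift ℓ γ p) :=
    ((h1.self_of_nhds.fderiv_right (m := 1) (by norm_num)).differentiableAt
      (by norm_num)).hasFDerivAt
  have hder := ((hdG.comp p hlift).clm_apply hlift2).congr_of_eventuallyEq hev
  refine ⟨hder.differentiableAt, fun u => ?_⟩
  have hNv := edgeNorm_nonneg ℓ β p v
  have hNu := edgeNorm_nonneg ℓ β p u
  obtain ⟨bv, bvu⟩ := hbound p hp h4.le v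
  have bu := (hbound p hp h4.le u).1
  rw [hder.fderiv]
  have hval : ∀ (A : E × (ι → ℝ) →L[ℝ] W) (B : E →L[ℝ] E × (ι → ℝ))
      (D : E × (ι → ℝ) →L[ℝ] E × (ι → ℝ) →L[ℝ] W) (x : E × (ι → ℝ)),
      ‖A‖ ≤ M → ‖D‖ ≤ M → ‖x‖ ≤ K * edgeNorm ℓ β p v →
      ‖B u‖ ≤ K * edgeNorm ℓ β p u * edgeNorm ℓ β p v →
      ‖(A.comp B + ((D.comp (fderiv ℝ (edgeLift ℓ γ) p)).flip) x) u‖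
        ≤ (M * K * K + M * K) * edgeNorm ℓ β p u * edgeNorm ℓ β p v := by
    intro A B D x hA hD hx hB
    calc _ ≤ ‖A (B u)‖ + ‖D (fderiv ℝ (edgeLift ℓ γ) p u) x‖ := norm_add_le _ _
      _ ≤ ‖A‖ * ‖B u‖ + ‖D‖ * ‖fderiv ℝ (edgeLift ℓ γ) p u‖ * ‖x‖ :=
          add_le_add (A.le_opNorm _) (D.le_opNorm₂ _ _)
      _ ≤ M * (K * edgeNorm ℓ β p u * edgeNorm ℓ β p v)
          + M * (K * edgeNorm ℓ β p u) * (K * edgeNorm ℓ β p v) := by gcongr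
      _ = _ := by ring
  exact hval _ _ _ _ h2.le h3.le bv (bvu u)

end EdgeCoordinates

section Wirtinger

variable {m : ℕ} {f : EuclideanSpace ℂ (Fin m) → ℂ} {p : EuclideanSpace ℂ (Fin m)}

/-- A bound on the real Hessian in unit coordinate directions controls the mixed
Wirtinger derivatives. -/
theorem norm_wdz_wdzbar_le (k l : Fin m) {B : ℝ}
    (hd : ∀ v, DifferentiableAt ℝ (fun q => fderiv ℝ f q v) p)
    (h : ∀ c d : ℂ, ‖c‖ = 1 → ‖d‖ = 1 →
      ‖fderiv ℝ (fun q => fderiv ℝ f q (EuclideanSpace.single l d)) p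
        (EuclideanSpace.single k c)‖ ≤ B) :
    ‖wdz k (wdzbar l f) p‖ ≤ B := by
  have hder : HasFDerivAt (wdzbar l f) ((1/2 : ℂ) •
      (fderiv ℝ (fun q => fderiv ℝ f q (EuclideanSpace.single l 1)) p +
        Complex.I • fderiv ℝ (fun q => fderiv ℝ f q (EuclideanSpace.single l Complex.I)) p)) p :=
    ((hd _).hasFDerivAt.add ((hd _).hasFDerivAt.const_mul Complex.I)).const_mul (1/2 : ℂ)
  rw [wdz, hder.fderiv]
  have h1 := h 1 1 (by simp) (by simp)
  have h2 := h 1 Complex.I (by simp) (by simp)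
  have h3 := h Complex.I 1 (by simp) (by simp)
  have h4 := h Complex.I Complex.I (by simp) (by simp)
  have key : ∀ x y z w : ℂ, ‖x‖ ≤ B → ‖y‖ ≤ B → ‖z‖ ≤ B → ‖w‖ ≤ B →
      ‖(1/2 : ℂ) * ((1/2 : ℂ) * (x + Complex.I * y)
        - Complex.I * ((1/2 : ℂ) * (z + Complex.I * w)))‖ ≤ B := by
    intro x y z w hx hy hz hw
    have e : (1/2 : ℂ) * ((1/2 : ℂ) * (x + Complex.I * y)
        - Complex.I * ((1/2 : ℂ) * (z + Complex.I * w)))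
        = (1/4 : ℂ) * ((x + Complex.I * y) - (Complex.I * z - w)) := by
      linear_combination (-1/4 * w) * Complex.I_sq
    have t1 := norm_add_le x (Complex.I * y)
    have t2 := norm_sub_le (Complex.I * z) w
    have t3 := norm_sub_le (x + Complex.I * y) (Complex.I * z - w)
    rw [norm_mul, Complex.norm_I, one_mul] at t1 t2
    rw [e, norm_mul, show ‖(1/4 : ℂ)‖ = 1/4 by norm_num]
    linarith
  exact key _ _ _ _ h1 h2 h3 h4

end Wirtinger

section RicciPotential

variable {n : ℕ}

/-- The exponents of `|ζ|` occurring in the Ricci potential. -/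
def ricciExponent (n : ℕ) (β : ℝ) : Fin (n+1) ⊕ Fin (n+2) → ℝ :=
  Sum.elim (fun m => 2*β*(m:ℝ)) (fun m => 2-2*β + 2*β*(m:ℝ))

theorem ricciExponent_eq_zero_or_le {β : ℝ} (hβ : β ∈ Set.Ioo (0 : ℝ) (1/2))
    (i : Fin (n+1) ⊕ Fin (n+2)) : ricciExponent n β i = 0 ∨ 2 * β ≤ ricciExponent n β i := by
  obtain ⟨h0, h1⟩ := hβ
  rcases i with m | m
  · rcases Nat.eq_zero_or_pos (m : ℕ) with h | h
    · left; simp [ricciExponent, h]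
    · right
      have : (1:ℝ) ≤ (m:ℕ) := by exact_mod_cast h
      simp only [ricciExponent, Sum.elim_inl]
      nlinarith
  · right
    have : (0:ℝ) ≤ (m:ℕ) := Nat.cast_nonneg _
    simp only [ricciExponent, Sum.elim_inr]
    nlinarith

/-- The Ricci potential with the powers of `|ζ|` replaced by independent variables. -/
def ricciSymbol (c : ℝ) (F₀ ρ : EuclideanSpace ℂ (Fin (n+1)) → ℝ)
    (a : Fin (n+1) → EuclideanSpace ℂ (Fin (n+1)) → ℝ)
    (b : Fin (n+2) → EuclideanSpace ℂ (Fin (n+1)) → ℝ)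
    (x : EuclideanSpace ℂ (Fin (n+1)) × (Fin (n+1) ⊕ Fin (n+2) → ℝ)) : ℂ :=
  ((F₀ x.1 - c * Real.log (ρ x.1) - Real.log ((∑ m, a m x.1 * x.2 (Sum.inl m))
    + ∑ m, b m x.1 * x.2 (Sum.inr m)) : ℝ) : ℂ)

theorem contDiffAt_ricciSymbol (c : ℝ) {F₀ ρ : EuclideanSpace ℂ (Fin (n+1)) → ℝ}
    {a : Fin (n+1) → EuclideanSpace ℂ (Fin (n+1)) → ℝ}
    {b : Fin (n+2) → EuclideanSpace ℂ (Fin (n+1)) → ℝ}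
    {x : EuclideanSpace ℂ (Fin (n+1)) × (Fin (n+1) ⊕ Fin (n+2) → ℝ)}
    (hF₀ : ContDiffAt ℝ 2 F₀ x.1) (hρ : ContDiffAt ℝ 2 ρ x.1)
    (ha : ∀ m, ContDiffAt ℝ 2 (a m) x.1) (hb : ∀ m, ContDiffAt ℝ 2 (b m) x.1)
    (hρx : ρ x.1 ≠ 0)
    (hx : (∑ m, a m x.1 * x.2 (Sum.inl m)) + ∑ m, b m x.1 * x.2 (Sum.inr m) ≠ 0) :
    ContDiffAt ℝ 2 (ricciSymbol c F₀ ρ a b) x := by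
  have coord : ∀ i, ContDiffAt ℝ 2 (fun y : EuclideanSpace ℂ (Fin (n+1)) ×
      (Fin (n+1) ⊕ Fin (n+2) → ℝ) => y.2 i) x := fun i => by fun_prop
  refine Complex.ofRealCLM.contDiff.contDiffAt.comp x (ContDiffAt.sub (ContDiffAt.sub ?_ ?_) ?_)
  · exact hF₀.comp x contDiffAt_fst
  · exact contDiffAt_const.mul ((hρ.comp x contDiffAt_fst).log hρx)
  · refine ContDiffAt.log (ContDiffAt.add ?_ ?_) hx
    · exact ContDiffAt.sum fun m _ => ((ha m).comp x contDiffAt_fst).mul (coord _)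
    · exact ContDiffAt.sum fun m _ => ((hb m).comp x contDiffAt_fst).mul (coord _)

end RicciPotential

theorem ricci_potential_ddbar_bound
    (n : ℕ) (β : ℝ) (hβ : β ∈ Set.Ioo (0 : ℝ) (1/2))
    (U : Set (EuclideanSpace ℂ (Fin (n+1)))) (hU : IsOpen U)
    (h0U : (0 : EuclideanSpace ℂ (Fin (n+1))) ∈ U)
    (F₀ ρ : EuclideanSpace ℂ (Fin (n+1)) → ℝ)
    (a : Fin (n+1) → EuclideanSpace ℂ (Fin (n+1)) → ℝ)
    (b : Fin (n+2) → EuclideanSpace ℂ (Fin (n+1)) → ℝ)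
    (hF₀ : ContDiffOn ℝ (⊤ : ℕ∞) F₀ U) (hρ : ContDiffOn ℝ (⊤ : ℕ∞) ρ U)
    (ha : ∀ m, ContDiffOn ℝ (⊤ : ℕ∞) (a m) U) (hb : ∀ m, ContDiffOn ℝ (⊤ : ℕ∞) (b m) U)
    (hρpos : ∀ p ∈ U, 0 < ρ p) (ha0 : ∀ p ∈ U, 0 < a 0 p)
    (F : EuclideanSpace ℂ (Fin (n+1)) → ℝ)
    (hF : ∀ p ∈ U, p (Fin.last n) ≠ 0 →
      F p = F₀ p - (1/β - 1) * Real.log (ρ p)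
        - Real.log ((∑ m : Fin (n+1), a m p * ‖p (Fin.last n)‖ ^ (2*β*(m:ℝ)))
          + ‖p (Fin.last n)‖ ^ (2-2*β)
            * ∑ m : Fin (n+2), b m p * ‖p (Fin.last n)‖ ^ (2*β*(m:ℝ)))) :
    ∃ r > (0:ℝ), ∃ C > (0:ℝ),
      Metric.ball (0 : EuclideanSpace ℂ (Fin (n+1))) r ⊆ U ∧
      (∀ p ∈ Metric.ball (0 : EuclideanSpace ℂ (Fin (n+1))) r,
        p (Fin.last n) ≠ 0 →
        (∑ k : Fin n, ∑ l : Fin n,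
            ‖wdz k.castSucc (wdzbar l.castSucc (fun q => (F q : ℂ))) p‖)
        + (∑ k : Fin n, ‖p (Fin.last n)‖ ^ (1-β) *
            (‖wdz k.castSucc (wdzbar (Fin.last n) (fun q => (F q : ℂ))) p‖
              + ‖wdz (Fin.last n) (wdzbar k.castSucc (fun q => (F q : ℂ))) p‖))
        + ‖p (Fin.last n)‖ ^ (2-2*β) *
            ‖wdz (Fin.last n) (wdzbar (Fin.last n) (fun q => (F q : ℂ))) p‖
        ≤ C + C * ‖p (Fin.last n)‖ ^ (2-4*β)) := by
  obtain ⟨hβ0, hβ1⟩ := id hβ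
  set ℓ : EuclideanSpace ℂ (Fin (n+1)) →L[ℝ] ℂ :=
    (EuclideanSpace.proj (𝕜 := ℂ) (Fin.last n)).restrictScalars ℝ
  have hℓa : ∀ p, ℓ p = p (Fin.last n) := fun p => rfl
  set γ := ricciExponent n β with hγ
  set G := ricciSymbol (1/β - 1) F₀ ρ a b with hGdef
  have hUn := hU.mem_nhds h0U
  have hle : (2 : WithTop ℕ∞) ≤ ((⊤ : ℕ∞) : WithTop ℕ∞) := 
    WithTop.coe_le_coe.2 le_top
  have hsmooth : ∀ {f : EuclideanSpace ℂ (Fin (n+1)) → ℝ}, ContDiffOn ℝ (⊤ : ℕ∞) f U →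
      ContDiffAt ℝ 2 f 0 := fun hf => (hf.contDiffAt hUn).of_le hle
  have hsum : (∑ m, a m 0 * (edgeLift ℓ γ 0).2 (Sum.inl m))
      + ∑ m, b m 0 * (edgeLift ℓ γ 0).2 (Sum.inr m) = a 0 0 := by
    have h1 : ∀ m : Fin (n+1), m ≠ 0 → (edgeLift ℓ γ 0).2 (Sum.inl m) = 0 := fun m hm => by
      have : 2 * β * ((m : ℕ) : ℝ) ≠ 0 := by
        have : ((m : ℕ) : ℝ) ≠ 0 := by exact_mod_cast Fin.val_ne_zero_iff.2 hm
        positivity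
      simp only [edgeLift, hγ, ricciExponent, Sum.elim_inl, map_zero, norm_zero,
        Real.zero_rpow this]
    have h2 : ∀ m : Fin (n+2), (edgeLift ℓ γ 0).2 (Sum.inr m) = 0 := fun m => by
      have : 2-2*β + 2*β*((m:ℕ):ℝ) ≠ 0 := by
        have : (0:ℝ) ≤ (m:ℕ) := Nat.cast_nonneg _
        nlinarith [mul_nonneg hβ0.le this]
      simp only [edgeLift, hγ, ricciExponent, Sum.elim_inr, map_zero, norm_zero,
        Real.zero_rpow this]
    rw [Finset.sum_eq_single 0 (fun m _ hm => by rw [h1 m hm, mul_zero]) (by simp)]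
    simp only [h2, mul_zero, Finset.sum_const_zero, add_zero]
    simp [edgeLift, hγ, ricciExponent]
  have hG : ContDiffAt ℝ 2 G (edgeLift ℓ γ 0) :=
    contDiffAt_ricciSymbol (x := edgeLift ℓ γ 0) _ (hsmooth hF₀) (hsmooth hρ)
      (fun m => hsmooth (ha m)) (fun m => hsmooth (hb m)) (hρpos 0 h0U).ne'
      (hsum.trans_ne (ha0 0 h0U).ne')
  obtain ⟨C, hC, hev⟩ := exists_norm_fderiv_fderiv_comp_edgeLift_le hβ0
    (ricciExponent_eq_zero_or_le hβ) ℓ hG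
  have hnear : ∀ᶠ p in nhds (0 : EuclideanSpace ℂ (Fin (n+1))), ‖ℓ p‖ < 1 :=
    (ℓ.continuous.norm.continuousAt (x := 0)).eventually_lt_const (by simp)
  obtain ⟨r, hr, hball⟩ := Metric.eventually_nhds_iff_ball.1
    ((hev.and hnear).and (hU.eventually_mem h0U))
  refine ⟨r, hr, n * (n * C) + n * (4 * C) + 4 * C, by positivity,
    fun p hp => (hball p hp).2, fun p hp hp0 => ?_⟩
  obtain ⟨⟨hH, hp1⟩, hpU⟩ := hball p hp
  have hs : 0 < ‖ℓ p‖ := norm_pos_iff.2 hp0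
  have hFG : (fun q => (F q : ℂ)) =ᶠ[nhds p] G ∘ edgeLift ℓ γ := by
    filter_upwards [hU.eventually_mem hpU, ℓ.continuous.continuousAt.eventually_ne hp0]
      with q hqU hq0
    have hq : 0 < ‖q (Fin.last n)‖ := norm_pos_iff.2 hq0
    simp only [hF q hqU hq0, hGdef, hγ, ricciSymbol, Function.comp_apply, edgeLift,
      ricciExponent, Sum.elim_inl, Sum.elim_inr, hℓa, Real.rpow_add hq, Finset.mul_sum,
      mul_left_comm]
  have hFG' : ∀ v, (fun q => fderiv ℝ (fun q => (F q : ℂ)) q v) =ᶠ[nhds p]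
      fun q => fderiv ℝ (G ∘ edgeLift ℓ γ) q v := fun v =>
    (hFG.fderiv (𝕜 := ℝ)).mono fun q hq => by simp only [hq]
  have hW : ∀ (k l : Fin (n+1)) {A B : ℝ},
      (∀ c : ℂ, ‖c‖ = 1 → edgeNorm ℓ β p (EuclideanSpace.single k c) ≤ A) →
      (∀ c : ℂ, ‖c‖ = 1 → edgeNorm ℓ β p (EuclideanSpace.single l c) ≤ B) →
      ‖wdz k (wdzbar l (fun q => (F q : ℂ))) p‖ ≤ C * A * B := by
    intro k l A B hA hB
    have hA0 : 0 ≤ A := (edgeNorm_nonneg ℓ β p _).trans (hA 1 (by simp))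
    refine norm_wdz_wdzbar_le k l
      (fun v => (hH hp0 v).1.congr_of_eventuallyEq (hFG' v)) fun c d hc hd => ?_
    rw [(hFG' _).fderiv_eq]
    refine ((hH hp0 _).2 _).trans ?_
    have := edgeNorm_nonneg ℓ β p (EuclideanSpace.single l d)
    gcongr
    exacts [hA c hc, hB d hd]
  have htan : ∀ (k : Fin n) (c : ℂ), ‖c‖ = 1 →
      edgeNorm ℓ β p (EuclideanSpace.single k.castSucc c) ≤ 1 := by
    intro k c hc
    have : ℓ (EuclideanSpace.single k.castSucc c) = 0 := by
      simp [hℓa, (Fin.castSucc_lt_last k).ne']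
    simp [edgeNorm, this, hc]
  have hnorm : ∀ c : ℂ, ‖c‖ = 1 →
      edgeNorm ℓ β p (EuclideanSpace.single (Fin.last n) c) ≤ 2 * ‖ℓ p‖ ^ (β - 1) := by
    intro c hc
    have h1 : ℓ (EuclideanSpace.single (Fin.last n) c) = c := by simp [hℓa]
    have h2 : 1 ≤ ‖ℓ p‖ ^ (β - 1) :=
      Real.one_le_rpow_of_pos_of_le_one_of_nonpos hs hp1.le (by linarith)
    simp only [edgeNorm, h1, hc, PiLp.norm_single]
    linarith
  have hone : ‖ℓ p‖ ^ (1 - β) * ‖ℓ p‖ ^ (β - 1) = 1 := by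
    rw [← Real.rpow_add hs]; simp
  have htwo : ‖ℓ p‖ ^ (2 - 2 * β) * (‖ℓ p‖ ^ (β - 1) * ‖ℓ p‖ ^ (β - 1)) = 1 := by
    rw [← Real.rpow_add hs, ← Real.rpow_add hs]; ring_nf; simp
  simp only [← hℓa]
  have b1 : (∑ k : Fin n, ∑ l : Fin n,
      ‖wdz k.castSucc (wdzbar l.castSucc (fun q => (F q : ℂ))) p‖) ≤ n * (n * C) := by
    calc _ ≤ ∑ _k : Fin n, ∑ _l : Fin n, C := by
          gcongr with k _ l _
          simpa using hW _ _ (htan k) (htan l)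
      _ = _ := by simp
  have b2 : (∑ k : Fin n, ‖ℓ p‖ ^ (1-β) *
      (‖wdz k.castSucc (wdzbar (Fin.last n) (fun q => (F q : ℂ))) p‖
        + ‖wdz (Fin.last n) (wdzbar k.castSucc (fun q => (F q : ℂ))) p‖)) ≤ n * (4 * C) := by
    calc _ ≤ ∑ _k : Fin n, ‖ℓ p‖ ^ (1-β) * (C * 1 * (2 * ‖ℓ p‖ ^ (β - 1))
            + C * (2 * ‖ℓ p‖ ^ (β - 1)) * 1) := by
          gcongr with k _
          exacts [hW _ _ (htan k) hnorm, hW _ _ hnorm (htan k)]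
      _ = n * (4 * C * (‖ℓ p‖ ^ (1 - β) * ‖ℓ p‖ ^ (β - 1))) := by
          rw [Finset.sum_const, Finset.card_univ, Fintype.card_fin, nsmul_eq_mul]; ring
      _ = _ := by rw [hone, mul_one]
  have b3 : ‖ℓ p‖ ^ (2-2*β) *
      ‖wdz (Fin.last n) (wdzbar (Fin.last n) (fun q => (F q : ℂ))) p‖ ≤ 4 * C := by
    calc _ ≤ ‖ℓ p‖ ^ (2-2*β) * (C * (2 * ‖ℓ p‖ ^ (β - 1)) * (2 * ‖ℓ p‖ ^ (β - 1))) := by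
          gcongr
          exact hW _ _ hnorm hnorm
      _ = 4 * C * (‖ℓ p‖ ^ (2 - 2 * β) * (‖ℓ p‖ ^ (β - 1) * ‖ℓ p‖ ^ (β - 1))) := by ring
      _ = _ := by rw [htwo, mul_one]
  have b4 : 0 ≤ (n * (n * C) + n * (4 * C) + 4 * C) * ‖ℓ p‖ ^ (2 - 4 * β) := by positivity
  linarith
end
end

section
/- For ζ ≠ 0 define the Hermitian matrix g by g_{μν̄} = (g₀)_{μν̄} + λ·∂_μ∂_ν̄(ρ·|ζ|^{2β}) (1 ≤ μ,ν ≤ n, with ζ the n-th coordinate). Then there exist a neighborhood W of 0 and smooth real-valued functions a₀,…,a_{n−1} and b₀,…,b_n on W, with a₀ > 0 everywhere, such that for all points of W with ζ ≠ 0: det(g)/det(g₀) = |ζ|^{2β−2}·Σ_{m=0}^{n−1} a_m |ζ|^{2βm} + Σ_{m=0}^{n} b_m |ζ|^{2βm}. -/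
/-!
STATEMENT 2: Expansion of the volume-form ratio for the background edge metric:
with g_{μν̄} = (g₀)_{μν̄} + λ·∂_μ∂_ν̄(ρ·|ζ|^{2β}), there are smooth functions
a₀,…,a_{n−1}, b₀,…,b_n on a neighborhood W of 0, with a₀ > 0, such that away from {ζ=0}
det(g)/det(g₀) = |ζ|^{2β−2}·Σ_{m<n} a_m |ζ|^{2βm} + Σ_{m≤n} b_m |ζ|^{2βm}.
The paper's dimension n ≥ 1 is rendered as `n + 1`; ζ is the last coordinate.
-/

noncomputable section

open Complex Metric Finset ComplexOrder

/-- A determinant has degree at most the sum of degree bounds for its rows. -/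
theorem natDegree_det_le_sum {R ι : Type*} [CommRing R] [Fintype ι] [DecidableEq ι]
    (M : Matrix ι ι (Polynomial R)) (d : ι → ℕ) (h : ∀ i j, (M i j).natDegree ≤ d i) :
    M.det.natDegree ≤ ∑ i, d i := by
  rw [Matrix.det_apply']
  refine Polynomial.natDegree_sum_le_of_forall_le _ _ fun σ _ => ?_
  refine Polynomial.natDegree_mul_le.trans ?_
  rw [Polynomial.natDegree_intCast, zero_add]
  refine (Polynomial.natDegree_prod_le _ _).trans ?_
  rw [← Equiv.sum_comp σ d]
  exact Finset.sum_le_sum fun i _ => h _ _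

/-- The increment, divided by `s`, of `det A` when `s • w • v` is added to row `k` of `A`,
`s • z • u` to its column `k`, and `s * c` to its entry `(k, k)`, for `t = s * (z * w)`;
see `det_border`. -/
def borderDet {K ι : Type*} [CommRing K] [Fintype ι] [DecidableEq ι] (k : ι)
    (A : Matrix ι ι K) (u v : ι → K) (c z w t : K) : K :=
  (A.updateCol k (z • u)).det + (A.updateRow k (w • v + Pi.single k c)).det +
    ((A.updateRow k v).updateCol k (t • Function.update u k 0)).det

theorem det_border {K ι : Type*} [CommRing K] [Fintype ι] [DecidableEq ι] (k : ι)
    (A : Matrix ι ι K) (u v : ι → K) (c z w t s : K) (hs : s * (z * w) = t) :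
    (Matrix.of fun i j => A i j + s * ((if i = k then w * v j else 0) +
      (if j = k then z * u i else 0) + (if i = k ∧ j = k then c else 0))).det =
    A.det + s * borderDet k A u v c z w t := by
  set r : ι → K := w • v + Pi.single k c with hr
  set B : Matrix ι ι K := A.updateCol k (fun i => A i k + s * (z * u i)) with hB
  have hBdet : B.det = A.det + s * (A.updateCol k (z • u)).det := by
    have : (fun i => A i k + s * (z * u i)) = (fun i => A i k) + s • (z • u) := by
      ext i; simp
    rw [hB, this, Matrix.det_updateCol_add, Matrix.det_updateCol_smul]
    congr 2
    ext i j; by_cases hj : j = k <;> simp [hj]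
  have h1 : (Matrix.of fun i j => A i j + s * ((if i = k then w * v j else 0) +
      (if j = k then z * u i else 0) + (if i = k ∧ j = k then c else 0))) =
      B.updateRow k (B k + s • r) := by
    ext i j
    by_cases hi : i = k <;> by_cases hj : j = k <;>
      simp [Matrix.updateRow_apply, hi, hj, hB, hr] <;> ring
  have h2 : B.updateRow k r = (A.updateRow k r).updateCol k
      ((fun i => A.updateRow k r i k) + s • (z • Function.update u k 0)) := by
    ext i j
    by_cases hi : i = k <;> by_cases hj : j = k <;>
      simp [Matrix.updateRow_apply, hi, hj, hB]
  have h3 : (A.updateRow k r).updateCol k (fun i => A.updateRow k r i k) = A.updateRow k r := by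
    ext i j; by_cases hj : j = k <;> simp [hj]
  have h4 : (A.updateRow k r).updateCol k (Function.update u k 0) =
      ((A.updateCol k (Function.update u k 0)).updateRow k
        (w • Function.update v k 0)) := by
    ext i j
    by_cases hi : i = k <;> by_cases hj : j = k <;>
      simp [Matrix.updateRow_apply, hi, hj, hr]
  have h5 : (A.updateRow k v).updateCol k (Function.update u k 0) =
      ((A.updateCol k (Function.update u k 0)).updateRow k (Function.update v k 0)) := by
    ext i j
    by_cases hi : i = k <;> by_cases hj : j = k <;>
      simp [Matrix.updateRow_apply, hi, hj]
  have h6 : B.updateRow k (B k) = B := Matrix.updateRow_eq_self _ _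
  rw [h1, Matrix.det_updateRow_add, Matrix.det_updateRow_smul, h6, hBdet, h2,
    Matrix.det_updateCol_add, h3, Matrix.det_updateCol_smul, Matrix.det_updateCol_smul,
    Matrix.det_updateCol_smul, h4,
    Matrix.det_updateRow_smul, borderDet,
    Matrix.det_updateCol_smul, Matrix.det_updateCol_smul, h5, ← hs]
  ring

theorem map_borderDet {K L ι : Type*} [CommRing K] [CommRing L] [Fintype ι] [DecidableEq ι]
    (φ : K →+* L) (k : ι) (A : Matrix ι ι K) (u v : ι → K) (c z w t : K) :
    φ (borderDet k A u v c z w t) =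
      borderDet k (A.map φ) (φ ∘ u) (φ ∘ v) (φ c) (φ z) (φ w) (φ t) := by
  simp only [borderDet, map_add, RingHom.map_det, RingHom.mapMatrix_apply]
  congr 3
  all_goals
    ext i j
    by_cases hi : i = k <;> by_cases hj : j = k <;>
      simp [Matrix.updateRow_apply, hi, hj]

theorem natDegree_borderDet_le {R : Type*} [CommRing R] {n : ℕ} (k : Fin (n + 1))
    (A : Matrix (Fin (n + 1)) (Fin (n + 1)) (Polynomial R)) (hA : ∀ i j, (A i j).natDegree ≤ 1)
    (u v : Fin (n + 1) → R) (c z w : R) :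
    (borderDet k A (fun i => .C (u i)) (fun i => .C (v i)) (.C c) (.C z) (.C w)
      Polynomial.X).natDegree ≤ n := by
  have hsum : ∑ i : Fin (n + 1), (if i = k then 0 else 1) = n := by
    rw [Finset.sum_ite, Finset.filter_ne' univ k]
    simp
  have key : ∀ M : Matrix (Fin (n + 1)) (Fin (n + 1)) (Polynomial R),
      (∀ i j, (M i j).natDegree ≤ if i = k then 0 else 1) → M.det.natDegree ≤ n := fun M hM =>
    (natDegree_det_le_sum M _ hM).trans hsum.le
  refine Polynomial.natDegree_add_le_of_degree_le
    (Polynomial.natDegree_add_le_of_degree_le ?_ (key _ fun i j => ?_)) (key _ fun i j => ?_)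
  · rw [← Matrix.det_transpose]
    refine key _ fun i j => ?_
    by_cases hi : i = k
    · simp [hi, ← Polynomial.C_mul, -map_mul]
    · simpa [Matrix.updateCol_apply, hi] using hA _ _
  · by_cases hi : i = k
    · by_cases hj : j = k <;>
        simp [hi, hj, ← Polynomial.C_mul, ← Polynomial.C_add, -map_mul, -map_add]
    · simpa [Matrix.updateRow_apply, hi] using hA _ _
  · by_cases hi : i = k
    · by_cases hj : j = k <;> simp [hi, hj]
    · by_cases hj : j = k
      · simpa [Matrix.updateCol_apply, hi, hj] using
          (Polynomial.natDegree_mul_le (p := Polynomial.X) (q := Polynomial.C (u i))).trans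
            (by simpa using Polynomial.natDegree_X_le)
      · simpa [Matrix.updateRow_apply, Matrix.updateCol_apply, hi, hj] using hA _ _

section Wirtinger

variable {n : ℕ} {f h : EuclideanSpace ℂ (Fin n) → ℂ} {p : EuclideanSpace ℂ (Fin n)}

theorem Filter.EventuallyEq.wdz_eq (i : Fin n) (hfh : f =ᶠ[nhds p] h) : wdz i f p = wdz i h p := by
  simp only [wdz, hfh.fderiv_eq]

theorem wdz_add (i : Fin n) (hf : DifferentiableAt ℝ f p) (hh : DifferentiableAt ℝ h p) :
    wdz i (fun q => f q + h q) p = wdz i f p + wdz i h p := by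
  simp only [wdz, fderiv_fun_add hf hh, add_apply]
  ring

theorem wdz_mul (i : Fin n) (hf : DifferentiableAt ℝ f p) (hh : DifferentiableAt ℝ h p) :
    wdz i (fun q => f q * h q) p = wdz i f p * h p + f p * wdz i h p := by
  simp only [wdz, fderiv_fun_mul hf hh, add_apply, smul_apply, smul_eq_mul]
  ring

theorem wdzbar_mul (i : Fin n) (hf : DifferentiableAt ℝ f p) (hh : DifferentiableAt ℝ h p) :
    wdzbar i (fun q => f q * h q) p = wdzbar i f p * h p + f p * wdzbar i h p := by
  simp only [wdzbar, fderiv_fun_mul hf hh, add_apply, smul_apply, smul_eq_mul]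
  ring

theorem wdz_const_mul (i : Fin n) (c : ℂ) (hf : DifferentiableAt ℝ f p) :
    wdz i (fun q => c * f q) p = c * wdz i f p := by
  simp only [wdz, fderiv_const_mul hf, smul_apply, smul_eq_mul]
  ring

theorem hasFDerivAt_coord (k : Fin n) (p : EuclideanSpace ℂ (Fin n)) :
    HasFDerivAt (fun q : EuclideanSpace ℂ (Fin n) => q k)
      ((EuclideanSpace.proj k : EuclideanSpace ℂ (Fin n) →L[ℂ] ℂ).restrictScalars ℝ) p :=
  ((EuclideanSpace.proj k : EuclideanSpace ℂ (Fin n) →L[ℂ] ℂ).restrictScalars ℝ).hasFDerivAt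

theorem wdz_coord (i k : Fin n) :
    wdz i (fun q : EuclideanSpace ℂ (Fin n) => q k) p = if i = k then 1 else 0 := by
  rw [wdz, (hasFDerivAt_coord k p).fderiv]
  by_cases h : i = k
  · simp [h]; norm_num
  · simp [h, Ne.symm h]

/-- The real derivative of `‖q k‖ ^ 2`. -/
theorem hasFDerivAt_normSq_coord (k : Fin n) (p : EuclideanSpace ℂ (Fin n)) :
    HasFDerivAt (fun q : EuclideanSpace ℂ (Fin n) => ‖q k‖ ^ 2)
      (2 • (innerSL ℝ (p k)).comp
        ((EuclideanSpace.proj k : EuclideanSpace ℂ (Fin n) →L[ℂ] ℂ).restrictScalars ℝ)) p :=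
  (hasFDerivAt_coord k p).norm_sq

theorem hasFDerivAt_norm_coord_rpow (k : Fin n) (r : ℝ) (hp : p k ≠ 0) :
    HasFDerivAt (fun q : EuclideanSpace ℂ (Fin n) => ((‖q k‖ ^ (2 * r) : ℝ) : ℂ))
      (Complex.ofRealCLM.comp ((r * ‖p k‖ ^ (2 * r - 2)) • (2 • (innerSL ℝ (p k)).comp
        ((EuclideanSpace.proj k : EuclideanSpace ℂ (Fin n) →L[ℂ] ℂ).restrictScalars ℝ)))) p := by
  have h0 : ‖p k‖ ^ 2 ≠ 0 := by simpa using hp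
  have h1 := (hasFDerivAt_normSq_coord k p).rpow_const (p := r) (Or.inl h0)
  have h2 : ∀ (x : ℂ) (y : ℝ), (‖x‖ ^ 2) ^ y = ‖x‖ ^ (2 * y) := fun x y => by
    rw [Real.rpow_mul (norm_nonneg _)]; norm_num
  simp only [h2] at h1
  rw [show 2 * (r - 1) = 2 * r - 2 by ring] at h1
  exact Complex.ofRealCLM.hasFDerivAt.comp p h1

theorem wdz_norm_coord_rpow (i k : Fin n) (r : ℝ) (hp : p k ≠ 0) :
    wdz i (fun q : EuclideanSpace ℂ (Fin n) => ((‖q k‖ ^ (2 * r) : ℝ) : ℂ)) p =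
      if i = k then r * ((‖p k‖ ^ (2 * r - 2) : ℝ) : ℂ) * star (p k) else 0 := by
  rw [wdz, (hasFDerivAt_norm_coord_rpow k r hp).fderiv]
  by_cases h : i = k
  · subst h
    simp [Complex.inner]
    apply Complex.ext <;> simp <;> ring
  · simp [h, Ne.symm h]

theorem wdzbar_norm_coord_rpow (i k : Fin n) (r : ℝ) (hp : p k ≠ 0) :
    wdzbar i (fun q : EuclideanSpace ℂ (Fin n) => ((‖q k‖ ^ (2 * r) : ℝ) : ℂ)) p =
      if i = k then r * ((‖p k‖ ^ (2 * r - 2) : ℝ) : ℂ) * p k else 0 := by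
  rw [wdzbar, (hasFDerivAt_norm_coord_rpow k r hp).fderiv]
  by_cases h : i = k
  · subst h
    simp [Complex.inner]
    apply Complex.ext <;> simp <;> ring
  · simp [h, Ne.symm h]

theorem ContDiffOn.wdz {U : Set (EuclideanSpace ℂ (Fin n))} (hU : IsOpen U)
    (hf : ContDiffOn ℝ (⊤ : ℕ∞) f U) (i : Fin n) : ContDiffOn ℝ (⊤ : ℕ∞) (wdz i f) U := by
  have h := hf.fderiv_of_isOpen (m := ((⊤ : ℕ∞) : WithTop ℕ∞)) hU (by simp)
  unfold _root_.wdz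
  fun_prop

theorem ContDiffOn.wdzbar {U : Set (EuclideanSpace ℂ (Fin n))} (hU : IsOpen U)
    (hf : ContDiffOn ℝ (⊤ : ℕ∞) f U) (i : Fin n) : ContDiffOn ℝ (⊤ : ℕ∞) (wdzbar i f) U := by
  have h := hf.fderiv_of_isOpen (m := ((⊤ : ℕ∞) : WithTop ℕ∞)) hU (by simp)
  unfold _root_.wdzbar
  fun_prop

/-- The complex Hessian of a real-valued function is Hermitian. -/
theorem star_wdz_wdzbar {r : EuclideanSpace ℂ (Fin n) → ℝ} (hr : ContDiffAt ℝ 2 r p)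
    (i j : Fin n) :
    star (wdz i (wdzbar j fun q => (r q : ℂ)) p) = wdz j (wdzbar i fun q => (r q : ℂ)) p := by
  set f : EuclideanSpace ℂ (Fin n) → ℂ := fun q => (r q : ℂ) with hf
  have hfc : ContDiffAt ℝ 2 f p := Complex.ofRealCLM.contDiff.contDiffAt.comp p hr
  have hsymm := hfc.isSymmSndFDerivAt (by simp)
  have hd : DifferentiableAt ℝ (fderiv ℝ f) p :=
    (hfc.fderiv_right (m := 1) (by norm_num)).differentiableAt (by norm_num)
  have happ : ∀ v, HasFDerivAt (fun q => fderiv ℝ f q v) ((fderiv ℝ (fderiv ℝ f) p).flip v) p :=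
    fun v => by simpa using hd.hasFDerivAt.clm_apply (hasFDerivAt_const v p)
  have hreal : ∀ v w, star (fderiv ℝ (fderiv ℝ f) p v w) = fderiv ℝ (fderiv ℝ f) p v w := by
    intro v w
    have hstar : ∀ q, star (fderiv ℝ f q w) = fderiv ℝ f q w := fun q => by
      have h1 : (fun q => star (f q)) = f := by ext q; simp [hf]
      have h2 := fderiv_star (𝕜 := ℝ) (f := f) (x := q)
      rw [h1] at h2
      conv_rhs => rw [h2]
      simp
    have h3 := (happ w).star
    simp only [hstar] at h3
    have h4 := congrArg (fun T => T v) (h3.unique (happ w))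
    simpa using h4
  have hexp : ∀ i j : Fin n, wdz i (wdzbar j f) p = (1 / 4 : ℂ) *
      (fderiv ℝ (fderiv ℝ f) p (.single i 1) (.single j 1) +
        I * fderiv ℝ (fderiv ℝ f) p (.single i 1) (.single j I) -
        I * fderiv ℝ (fderiv ℝ f) p (.single i I) (.single j 1) +
        fderiv ℝ (fderiv ℝ f) p (.single i I) (.single j I)) := by
    intro i j
    have h : HasFDerivAt (wdzbar j f) _ p :=
      ((happ (.single j 1)).add ((happ (.single j I)).const_mul I)).const_mul (1 / 2 : ℂ)
    rw [wdz, h.fderiv]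
    simp
    linear_combination (-(1 / 4) * fderiv ℝ (fderiv ℝ f) p (.single i I) (.single j I)) * I_sq
  rw [hexp, hexp]
  simp only [star_mul', star_add, star_sub, hreal]
  rw [hsymm.eq (.single i 1) (.single j 1), hsymm.eq (.single i 1) (.single j I),
    hsymm.eq (.single i I) (.single j 1), hsymm.eq (.single i I) (.single j I)]
  simp
  ring

theorem wdz_wdzbar_mul_norm_coord_rpow (hf : ∀ᶠ q in nhds p, DifferentiableAt ℝ f q)
    (hf' : ∀ j, DifferentiableAt ℝ (wdzbar j f) p) (k : Fin n) (β : ℝ) (hp : p k ≠ 0)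
    (i j : Fin n) :
    wdz i (wdzbar j fun q => f q * ((‖q k‖ ^ (2 * β) : ℝ) : ℂ)) p =
      ((‖p k‖ ^ (2 * β) : ℝ) : ℂ) * wdz i (wdzbar j f) p +
      ((‖p k‖ ^ (2 * β - 2) : ℝ) : ℂ) * ((if i = k then star (p k) * (β * wdzbar j f p) else 0) +
        (if j = k then p k * (β * wdz i f p) else 0) +
        (if i = k ∧ j = k then β ^ 2 * f p else 0)) := by
  have hopen : ∀ᶠ q : EuclideanSpace ℂ (Fin n) in nhds p, q k ≠ 0 :=
    (hasFDerivAt_coord k p).continuousAt.eventually_ne hp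
  have hpow : ∀ r : ℝ, DifferentiableAt ℝ
      (fun q : EuclideanSpace ℂ (Fin n) => ((‖q k‖ ^ (2 * r) : ℝ) : ℂ)) p := fun r =>
    (hasFDerivAt_norm_coord_rpow k r hp).differentiableAt
  have hpow' := hpow (β - 1)
  have hz := wdz_norm_coord_rpow i k (β - 1) hp
  rw [show 2 * (β - 1) = 2 * β - 2 by ring] at hpow' hz
  have hcoord := (hasFDerivAt_coord k p).differentiableAt
  have hsc := hpow'.fun_mul hcoord
  have hsc' : DifferentiableAt ℝ (fun q : EuclideanSpace ℂ (Fin n) =>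
      (β : ℂ) * (((‖q k‖ ^ (2 * β - 2) : ℝ) : ℂ) * q k)) p := hsc.const_mul _
  have hnorm : ((‖p k‖ ^ (2 * β - 2 - 2) : ℝ) : ℂ) * (star (p k) * p k) =
      ((‖p k‖ ^ (2 * β - 2) : ℝ) : ℂ) := by
    have h0 : 0 < ‖p k‖ := norm_pos_iff.2 hp
    rw [Complex.star_def, Complex.conj_mul', Real.rpow_sub h0 (2 * β - 2) 2]
    have : ((‖p k‖ : ℝ) : ℂ) ≠ 0 := by exact_mod_cast h0.ne'
    push_cast
    simp
    field_simp
  by_cases hj : j = k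
  · have heq : (wdzbar j fun q => f q * ((‖q k‖ ^ (2 * β) : ℝ) : ℂ)) =ᶠ[nhds p] fun q =>
        wdzbar j f q * ((‖q k‖ ^ (2 * β) : ℝ) : ℂ) +
          f q * (β * (((‖q k‖ ^ (2 * β - 2) : ℝ) : ℂ) * q k)) := by
      filter_upwards [hf, hopen] with q hfq hq
      rw [wdzbar_mul j hfq (hasFDerivAt_norm_coord_rpow k β hq).differentiableAt,
        wdzbar_norm_coord_rpow j k β hq, if_pos hj]
      ring
    rw [heq.wdz_eq, wdz_add i ((hf' j).fun_mul (hpow β)) (hf.self_of_nhds.fun_mul hsc'),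
      wdz_mul i (hf' j) (hpow β), wdz_mul i hf.self_of_nhds hsc', wdz_const_mul i _ hsc, wdz_mul i hpow' hcoord, hz,
      wdz_norm_coord_rpow i k β hp, wdz_coord]
    by_cases hi : i = k
    · simp only [hi, hj, if_true, and_self]
      push_cast
      linear_combination (f p * β * (β - 1)) * hnorm
    · simp only [hi, hj, if_true, if_false, false_and]
      ring
  · have heq : (wdzbar j fun q => f q * ((‖q k‖ ^ (2 * β) : ℝ) : ℂ)) =ᶠ[nhds p] fun q =>
        wdzbar j f q * ((‖q k‖ ^ (2 * β) : ℝ) : ℂ) := by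
      filter_upwards [hf, hopen] with q hfq hq
      rw [wdzbar_mul j hfq (hasFDerivAt_norm_coord_rpow k β hq).differentiableAt,
        wdzbar_norm_coord_rpow j k β hq, if_neg hj]
      ring
    rw [heq.wdz_eq, wdz_mul i (hf' j) (hpow β), wdz_norm_coord_rpow i k β hp]
    by_cases hi : i = k
    · simp only [hi, hj, if_true, if_false, and_false]
      ring
    · simp only [hi, hj, if_false, and_false]
      ring

end Wirtinger

/-- The ring of complex-valued functions that are smooth on `U`. -/
def smoothSubring {E : Type*} [NormedAddCommGroup E] [NormedSpace ℝ E] (U : Set E) :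
    Subring (E → ℂ) where
  carrier := {f | ContDiffOn ℝ (⊤ : ℕ∞) f U}
  mul_mem' hf hg := ContDiffOn.mul hf hg
  one_mem' := contDiffOn_const
  add_mem' hf hg := ContDiffOn.add hf hg
  zero_mem' := contDiffOn_const
  neg_mem' hf := ContDiffOn.neg hf

theorem volume_ratio_expansion
    (n : ℕ) (β : ℝ) (hβ : β ∈ Set.Ioo (0 : ℝ) (1/2))
    (U : Set (EuclideanSpace ℂ (Fin (n+1)))) (hU : IsOpen U)
    (h0U : (0 : EuclideanSpace ℂ (Fin (n+1))) ∈ U)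
    (g₀ : EuclideanSpace ℂ (Fin (n+1)) → Fin (n+1) → Fin (n+1) → ℂ)
    (hg₀smooth : ∀ μ ν, ContDiffOn ℝ (⊤ : ℕ∞) (fun p => g₀ p μ ν) U)
    (hg₀pos : ∀ p ∈ U, (Matrix.of (g₀ p)).PosDef)
    (ρ : EuclideanSpace ℂ (Fin (n+1)) → ℝ)
    (hρ : ContDiffOn ℝ (⊤ : ℕ∞) ρ U) (hρpos : ∀ p ∈ U, 0 < ρ p)
    (lam : ℝ) (hlam : 0 < lam)
    -- the metric g_{μν̄} = (g₀)_{μν̄} + λ ∂_μ ∂_ν̄ (ρ |ζ|^{2β}), defined for ζ ≠ 0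
    (g : EuclideanSpace ℂ (Fin (n+1)) → Fin (n+1) → Fin (n+1) → ℂ)
    (hg : ∀ p, p (Fin.last n) ≠ 0 → ∀ μ ν, g p μ ν = g₀ p μ ν +
      (lam : ℂ) * wdz μ (wdzbar ν
        (fun q => (ρ q : ℂ) * ((‖q (Fin.last n)‖ ^ (2*β) : ℝ) : ℂ))) p) :
    ∃ W : Set (EuclideanSpace ℂ (Fin (n+1))), IsOpen W ∧
      (0 : EuclideanSpace ℂ (Fin (n+1))) ∈ W ∧ W ⊆ U ∧
      ∃ a : Fin (n+1) → EuclideanSpace ℂ (Fin (n+1)) → ℝ,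
      ∃ b : Fin (n+2) → EuclideanSpace ℂ (Fin (n+1)) → ℝ,
        (∀ m, ContDiffOn ℝ (⊤ : ℕ∞) (a m) W) ∧ (∀ m, ContDiffOn ℝ (⊤ : ℕ∞) (b m) W) ∧
        (∀ p ∈ W, 0 < a 0 p) ∧
        (∀ p ∈ W, p (Fin.last n) ≠ 0 →
          (Matrix.of (g p)).det / (Matrix.of (g₀ p)).det =
            ((‖p (Fin.last n)‖ ^ (2*β-2)
                * ∑ m : Fin (n+1), a m p * ‖p (Fin.last n)‖ ^ (2*β*(m:ℝ))
              + ∑ m : Fin (n+2), b m p * ‖p (Fin.last n)‖ ^ (2*β*(m:ℝ)) : ℝ) : ℂ)) := by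
  set k : Fin (n + 1) := Fin.last n with hk
  set ρc : EuclideanSpace ℂ (Fin (n + 1)) → ℂ := fun q => (ρ q : ℂ) with hρc
  have hρcs : ContDiffOn ℝ (⊤ : ℕ∞) ρc U := Complex.ofRealCLM.contDiff.comp_contDiffOn hρ
  let R := smoothSubring U
  have hcoord : ContDiff ℝ (⊤ : ℕ∞) fun q : EuclideanSpace ℂ (Fin (n + 1)) => q k :=
    ((EuclideanSpace.proj k : EuclideanSpace ℂ (Fin (n + 1)) →L[ℂ] ℂ).restrictScalars ℝ).contDiff
  let G : Fin (n + 1) → Fin (n + 1) → R := fun μ ν => ⟨fun p => g₀ p μ ν, hg₀smooth μ ν⟩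
  let H : Fin (n + 1) → Fin (n + 1) → R := fun μ ν =>
    ⟨fun p => lam * wdz μ (wdzbar ν ρc) p, contDiffOn_const.mul ((hρcs.wdzbar hU ν).wdz hU μ)⟩
  let u : Fin (n + 1) → R := fun μ =>
    ⟨fun p => lam * β * wdz μ ρc p, contDiffOn_const.mul (hρcs.wdz hU μ)⟩
  let v : Fin (n + 1) → R := fun ν =>
    ⟨fun p => lam * β * wdzbar ν ρc p, contDiffOn_const.mul (hρcs.wdzbar hU ν)⟩
  let c : R := ⟨fun p => lam * β ^ 2 * ρc p, contDiffOn_const.mul hρcs⟩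
  let z : R := ⟨fun p => p k, hcoord.contDiffOn⟩
  let w : R := ⟨fun p => star (p k),
    ((starL' ℝ : ℂ ≃L[ℝ] ℂ).contDiff.comp hcoord).contDiffOn⟩
  let A : Matrix (Fin (n + 1)) (Fin (n + 1)) (Polynomial R) :=
    Matrix.of fun μ ν => .C (G μ ν) + .X * .C (H μ ν)
  have hA : ∀ i j, (A i j).natDegree ≤ 1 := by
    intro i j
    rw [show A i j = .C (G i j) + .X * .C (H i j) from rfl]
    refine Polynomial.natDegree_add_le_of_degree_le (by simp)
      (Polynomial.natDegree_mul_le.trans ?_)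
    rw [Polynomial.natDegree_C]
    exact Polynomial.natDegree_X_le
  let P : Polynomial R :=
    borderDet k A (fun i => .C (u i)) (fun i => .C (v i)) (.C c) (.C z) (.C w) .X
  have hP : P.natDegree < n + 1 := Nat.lt_succ_of_le (natDegree_borderDet_le k A hA u v c z w)
  have hQ : A.det.natDegree < n + 2 := Nat.lt_succ_of_le
    ((natDegree_det_le_sum A (fun _ => 1) hA).trans (by simp))
  let ev : EuclideanSpace ℂ (Fin (n + 1)) → R →+* ℂ := fun p =>
    (Pi.evalRingHom (fun _ => ℂ) p).comp R.subtype
  have hev : ∀ p (f : R), ev p f = (f : EuclideanSpace ℂ (Fin (n + 1)) → ℂ) p := fun _ _ => rfl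
  have hmapA : ∀ p (t : ℂ), A.map (Polynomial.eval₂RingHom (ev p) t) =
      Matrix.of fun μ ν => g₀ p μ ν + t * (lam * wdz μ (wdzbar ν ρc) p) := by
    intro p t
    ext μ ν
    simp [A, hev, G, H]
    exact mul_comm _ _
  have hmapP : ∀ p (t : ℂ), P.eval₂ (ev p) t = borderDet k
      (Matrix.of fun μ ν => g₀ p μ ν + t * (lam * wdz μ (wdzbar ν ρc) p))
      (fun μ => lam * β * wdz μ ρc p) (fun ν => lam * β * wdzbar ν ρc p)
      (lam * β ^ 2 * ρc p) (p k) (star (p k)) t := by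
    intro p t
    rw [← hmapA, ← Polynomial.coe_eval₂RingHom, map_borderDet]
    congr 1
    all_goals first | (ext i; simp [hev, u, v]) | simp [hev, c, z, w]
  have hmapQ : ∀ p (t : ℂ), A.det.eval₂ (ev p) t =
      (Matrix.of fun μ ν => g₀ p μ ν + t * (lam * wdz μ (wdzbar ν ρc) p)).det := by
    intro p t
    rw [← hmapA, ← Polynomial.coe_eval₂RingHom, RingHom.map_det, RingHom.mapMatrix_apply]
  have hdet0 : ∀ p ∈ U, (Matrix.of (g₀ p)).det ≠ 0 := fun p hp => (hg₀pos p hp).det_pos.ne'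
  have hdetsmooth : ContDiffOn ℝ (⊤ : ℕ∞) (fun p => (Matrix.of (g₀ p)).det) U := by
    simp only [Matrix.det_apply', Matrix.of_apply]
    exact ContDiffOn.sum fun σ _ => contDiffOn_const.mul
      (contDiffOn_prod fun i _ => hg₀smooth _ _)
  have hsmooth : ∀ f : R, ContDiffOn ℝ (⊤ : ℕ∞)
      (fun p => ((f : EuclideanSpace ℂ (Fin (n + 1)) → ℂ) p / (Matrix.of (g₀ p)).det).re) U :=
    fun f =>
      have hf : ContDiffOn ℝ (⊤ : ℕ∞) (f : EuclideanSpace ℂ (Fin (n + 1)) → ℂ) U := f.2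
      Complex.reCLM.contDiff.comp_contDiffOn (by
        simpa only [div_eq_mul_inv] using hf.mul (hdetsmooth.inv hdet0))
  let a : Fin (n + 1) → EuclideanSpace ℂ (Fin (n + 1)) → ℝ := fun m p =>
    ((P.coeff m : EuclideanSpace ℂ (Fin (n + 1)) → ℂ) p / (Matrix.of (g₀ p)).det).re
  let b : Fin (n + 2) → EuclideanSpace ℂ (Fin (n + 1)) → ℝ := fun m p =>
    ((A.det.coeff m : EuclideanSpace ℂ (Fin (n + 1)) → ℂ) p / (Matrix.of (g₀ p)).det).re
  have ha0 : 0 < a 0 0 := by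
    have h1 : (P.coeff 0 : EuclideanSpace ℂ (Fin (n + 1)) → ℂ) 0 =
        lam * β ^ 2 * ρ 0 * (Matrix.of (g₀ 0)).adjugate k k := by
      have h2 : ev 0 (P.coeff 0) = P.eval₂ (ev 0) 0 := by simp [Polynomial.eval₂_at_zero]
      have h3 : (P.coeff 0 : EuclideanSpace ℂ (Fin (n + 1)) → ℂ) 0 = ev 0 (P.coeff 0) := rfl
      have h4 : (Pi.single k (lam * β ^ 2 * ρ 0 : ℂ) : Fin (n + 1) → ℂ) =
          (lam * β ^ 2 * ρ 0 : ℂ) • Pi.single k (1 : ℂ) := by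
        rw [← Pi.single_smul]; simp
      have h5 : ∀ M : Matrix (Fin (n + 1)) (Fin (n + 1)) ℂ, (M.updateCol k 0).det = 0 := fun M =>
        Matrix.det_eq_zero_of_column_eq_zero k (by simp)
      rw [h3, h2, hmapP, borderDet, Matrix.adjugate_apply]
      simp only [PiLp.zero_apply, star_zero, zero_smul, zero_add, zero_mul, add_zero, h5, hρc]
      rw [h4, Matrix.det_updateRow_smul]
    have h6 : (Matrix.of (g₀ 0))⁻¹ k k =
        (Matrix.of (g₀ 0)).adjugate k k / (Matrix.of (g₀ 0)).det := by
      rw [Matrix.inv_def, Ring.inverse_eq_inv', Matrix.smul_apply, smul_eq_mul, div_eq_inv_mul]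
    have h7 : 0 < ((Matrix.of (g₀ 0))⁻¹ k k).re :=
      (Complex.pos_iff.1 (hg₀pos 0 h0U).inv.diag_pos).1
    have h8 : a 0 0 = lam * β ^ 2 * ρ 0 * ((Matrix.of (g₀ 0))⁻¹ k k).re := by
      change ((P.coeff 0 : EuclideanSpace ℂ (Fin (n + 1)) → ℂ) 0 / _).re = _
      rw [h1, mul_div_assoc, ← h6, ← Complex.re_ofReal_mul]
      push_cast
      rfl
    rw [h8]
    have := hρpos 0 h0U
    have := hβ.1
    positivity
  refine ⟨{p ∈ U | 0 < a 0 p}, ?_, ⟨h0U, ha0⟩, fun p hp => hp.1, a, b,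
    fun m => (hsmooth _).mono fun p hp => hp.1, fun m => (hsmooth _).mono fun p hp => hp.1,
    fun p hp => hp.2, ?_⟩
  · exact (hsmooth _).continuousOn.isOpen_inter_preimage hU isOpen_Ioi
  rintro p ⟨hp, -⟩ hpk
  have hUp : U ∈ nhds p := hU.mem_nhds hp
  have hnorm : 0 < ‖p k‖ := norm_pos_iff.2 hpk
  have hherm : (Matrix.of (g p)).IsHermitian := by
    have hr : ContDiffAt ℝ 2 (fun q => ρ q * ‖q k‖ ^ (2 * β)) p := by
      have h1 : ContDiffAt ℝ 2 ρ p :=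
        (hρ.contDiffAt hUp).of_le (WithTop.coe_le_coe.2 (le_top : (2 : ℕ∞) ≤ ⊤))
      have h2 : ContDiffAt ℝ 2 (fun q : EuclideanSpace ℂ (Fin (n + 1)) => q k) p :=
        hcoord.contDiffAt.of_le (WithTop.coe_le_coe.2 (le_top : (2 : ℕ∞) ≤ ⊤))
      exact h1.mul ((h2.norm ℝ hpk).rpow_const_of_ne hnorm.ne')
    ext μ ν
    have h0 := (hg₀pos p hp).isHermitian.apply μ ν
    have h1 := star_wdz_wdzbar hr ν μ
    simp only [Complex.ofReal_mul] at h1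
    simp only [Matrix.conjTranspose_apply, Matrix.of_apply, hg p hpk, star_add, star_mul',
      h1] at h0 ⊢
    rw [h0]
    simp
  have hreal : ((Matrix.of (g p)).det / (Matrix.of (g₀ p)).det) =
      (((Matrix.of (g p)).det / (Matrix.of (g₀ p)).det).re : ℂ) := by
    have h1 : ∀ M : Matrix (Fin (n + 1)) (Fin (n + 1)) ℂ, M.IsHermitian → star M.det = M.det :=
      fun M hM => by rw [← Matrix.det_conjTranspose, hM.eq]
    refine (Complex.conj_eq_iff_re.1 ?_).symm
    rw [map_div₀, ← Complex.star_def, h1 _ hherm, h1 _ (hg₀pos p hp).isHermitian]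
  set t : ℝ := ‖p k‖ ^ (2 * β) with ht
  set s : ℝ := ‖p k‖ ^ (2 * β - 2) with hs
  have hst : (s : ℂ) * (p k * star (p k)) = t := by
    rw [Complex.star_def, Complex.mul_conj', hs, ht, Real.rpow_sub hnorm]
    have : ((‖p k‖ : ℝ) : ℂ) ≠ 0 := by exact_mod_cast hnorm.ne'
    push_cast
    simp
    field_simp
  have hgdet : (Matrix.of (g p)).det = A.det.eval₂ (ev p) t + s * P.eval₂ (ev p) t := by
    rw [hmapQ, hmapP, ← det_border k _ _ _ _ _ _ _ _ hst]
    congr 1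
    ext μ ν
    have hd : ∀ᶠ q in nhds p, DifferentiableAt ℝ ρc q := by
      filter_upwards [hUp] with q hq
      exact (hρcs.contDiffAt (hU.mem_nhds hq)).differentiableAt (by simp)
    have hd' : ∀ j, DifferentiableAt ℝ (wdzbar j ρc) p := fun j =>
      ((hρcs.wdzbar hU j).contDiffAt hUp).differentiableAt (by simp)
    simp only [Matrix.of_apply, hg p hpk]
    have := wdz_wdzbar_mul_norm_coord_rpow hd hd' k β hpk μ ν
    simp only [hρc] at this ⊢
    rw [this]
    split_ifs <;> ring
  have hpow : ∀ m : ℕ, ‖p k‖ ^ (2 * β * (m : ℝ)) = t ^ m := fun m => by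
    rw [Real.rpow_mul hnorm.le, Real.rpow_natCast]
  rw [hreal, hgdet, Polynomial.eval₂_eq_sum_range' _ hP, Polynomial.eval₂_eq_sum_range' _ hQ]
  congr 1
  simp only [hpow]
  rw [← Fin.sum_univ_eq_sum_range (fun i => ev p (P.coeff i) * (t : ℂ) ^ i),
    ← Fin.sum_univ_eq_sum_range (fun i => ev p (A.det.coeff i) * (t : ℂ) ^ i), add_comm, add_div,
    mul_div_assoc, Complex.add_re, Complex.re_ofReal_mul, Finset.sum_div, Finset.sum_div,
    Complex.re_sum, Complex.re_sum]
  have hterm : ∀ (f : R) (m : ℕ), (ev p f * (t : ℂ) ^ m / (Matrix.of (g₀ p)).det).re =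
      ((f : EuclideanSpace ℂ (Fin (n + 1)) → ℂ) p / (Matrix.of (g₀ p)).det).re * t ^ m := by
    intro f m
    rw [mul_div_right_comm, ← Complex.ofReal_pow, Complex.re_mul_ofReal]
    rfl
  simp only [hterm, a, b]
end
end

section
/- Fix α ∈ (0,1) and β ∈ (0,1/2) with αβ < 1 − 2β. Let f̃: B₁(0) ⊆ ℂ → ℂ be α-Hölder continuous, and let v be a smooth function on the punctured disk B₁(0)∖{0} ⊆ ℂ with sup_{B₁(0)∖{0}} |v| < ∞, satisfying |ζ|^{2−2β}·(∂²v/∂ζ∂ζ̄)(ζ) = f̃(|ζ|^{β−1}ζ) for all ζ ∈ B₁(0)∖{0}. Then there exist C > 0 and r ∈ (0,1) such that for all 0 < |ζ| < r: | |ζ|^{2−2β}·( (∂²v/∂ζ²)(ζ) + ((1−β)/ζ)·(∂v/∂ζ)(ζ) ) | ≤ C·|ζ|^{αβ}. -/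
noncomputable section

open Complex Metric

/-- Wirtinger derivative ∂f/∂ζ on ℂ. -/
def wdz1 (f : ℂ → ℂ) (z : ℂ) : ℂ :=
  (1/2 : ℂ) * (fderiv ℝ f z 1 - Complex.I * fderiv ℝ f z Complex.I)

/-- Wirtinger derivative ∂f/∂ζ̄ on ℂ. -/
def wdzbar1 (f : ℂ → ℂ) (z : ℂ) : ℂ :=
  (1/2 : ℂ) * (fderiv ℝ f z 1 + Complex.I * fderiv ℝ f z Complex.I)

section

open Set Filter Topology

/-- The Wirtinger derivatives determine the real differential. -/
lemma fderiv_apply_eq_wirtinger (f : ℂ → ℂ) (z h : ℂ) :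
    fderiv ℝ f z h = wdz1 f z * h + wdzbar1 f z * (starRingEnd ℂ) h := by
  have hh : fderiv ℝ f z h = (h.re : ℂ) * fderiv ℝ f z 1 + (h.im : ℂ) * fderiv ℝ f z I := by
    have h1 : h = h.re • (1 : ℂ) + h.im • I := by
      simp [Complex.re_add_im]
    conv_lhs => rw [h1]
    rw [map_add, map_smul, map_smul]
    simp
  rw [hh, wdz1, wdzbar1]
  apply sub_eq_zero.mp
  have e1 : (h.re : ℂ) = (h + (starRingEnd ℂ) h) / 2 := by
    rw [Complex.add_conj]; push_cast; ring
  have e2 : (h.im : ℂ) = -I * (h - (starRingEnd ℂ) h) / 2 := by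
    rw [Complex.sub_conj]; push_cast; ring_nf; simp
  rw [e1, e2]
  ring_nf

lemma fderiv_one_eq (f : ℂ → ℂ) (z : ℂ) : fderiv ℝ f z 1 = wdz1 f z + wdzbar1 f z := by
  simp [fderiv_apply_eq_wirtinger f z 1]

lemma fderiv_I_eq (f : ℂ → ℂ) (z : ℂ) :
    fderiv ℝ f z I = I * (wdz1 f z - wdzbar1 f z) := by
  rw [fderiv_apply_eq_wirtinger f z I, Complex.conj_I]; ring

/-- Chain rule along a curve. -/
lemma HasDerivAt.wirtinger_comp {f : ℂ → ℂ} {γ : ℝ → ℂ} {γ' : ℂ} {r : ℝ}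
    (hγ : HasDerivAt γ γ' r) (hf : DifferentiableAt ℝ f (γ r)) :
    HasDerivAt (fun s => f (γ s))
      (wdz1 f (γ r) * γ' + wdzbar1 f (γ r) * (starRingEnd ℂ) γ') r := by
  rw [← fderiv_apply_eq_wirtinger]
  exact hf.hasFDerivAt.comp_hasDerivAt r hγ

lemma HasFDerivAt.wdz1_eq {f : ℂ → ℂ} {L : ℂ →L[ℝ] ℂ} {z a b : ℂ} (hf : HasFDerivAt f L z)
    (hL : ∀ h, L h = a * h + b * (starRingEnd ℂ) h) : wdz1 f z = a := by
  rw [wdz1, hf.fderiv, hL, hL]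
  simp only [map_one, Complex.conj_I]
  linear_combination (-(1/2 : ℂ) * a + (1/2 : ℂ) * b) * I_mul_I

lemma HasFDerivAt.wdzbar1_eq {f : ℂ → ℂ} {L : ℂ →L[ℝ] ℂ} {z a b : ℂ} (hf : HasFDerivAt f L z)
    (hL : ∀ h, L h = a * h + b * (starRingEnd ℂ) h) : wdzbar1 f z = b := by
  rw [wdzbar1, hf.fderiv, hL, hL]
  simp only [map_one, Complex.conj_I]
  linear_combination ((1/2 : ℂ) * a - (1/2 : ℂ) * b) * I_mul_I

lemma contDiffOn_fderiv_apply {f : ℂ → ℂ} {U : Set ℂ} (hU : IsOpen U)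
    (hf : ContDiffOn ℝ (⊤ : ℕ∞) f U) (h : ℂ) :
    ContDiffOn ℝ (⊤ : ℕ∞) (fun z => fderiv ℝ f z h) U :=
  (hf.fderiv_of_isOpen hU (by simp)).clm_apply contDiffOn_const

lemma contDiffOn_wdz1 {f : ℂ → ℂ} {U : Set ℂ} (hU : IsOpen U)
    (hf : ContDiffOn ℝ (⊤ : ℕ∞) f U) : ContDiffOn ℝ (⊤ : ℕ∞) (wdz1 f) U :=
  contDiffOn_const.mul ((contDiffOn_fderiv_apply hU hf 1).sub
    (contDiffOn_const.mul (contDiffOn_fderiv_apply hU hf I)))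

lemma contDiffOn_wdzbar1 {f : ℂ → ℂ} {U : Set ℂ} (hU : IsOpen U)
    (hf : ContDiffOn ℝ (⊤ : ℕ∞) f U) : ContDiffOn ℝ (⊤ : ℕ∞) (wdzbar1 f) U :=
  contDiffOn_const.mul ((contDiffOn_fderiv_apply hU hf 1).add
    (contDiffOn_const.mul (contDiffOn_fderiv_apply hU hf I)))

lemma ContDiffOn.diffAt {f : ℂ → ℂ} {U : Set ℂ} (hU : IsOpen U)
    (hf : ContDiffOn ℝ (⊤ : ℕ∞) f U) {z : ℂ} (hz : z ∈ U) : DifferentiableAt ℝ f z :=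
  (hf.differentiableOn (by simp)).differentiableAt (hU.mem_nhds hz)

lemma wdz1_congr {f g : ℂ → ℂ} {z : ℂ} (h : f =ᶠ[𝓝 z] g) : wdz1 f z = wdz1 g z := by
  rw [wdz1, wdz1, h.fderiv_eq]

/-- Directional second derivatives of a smooth function. -/
lemma fderiv_fderiv_apply {f : ℂ → ℂ} {U : Set ℂ} (hU : IsOpen U)
    (hf : ContDiffOn ℝ (⊤ : ℕ∞) f U) {z : ℂ} (hz : z ∈ U) (h k : ℂ) :
    fderiv ℝ (fun z => fderiv ℝ f z h) z k = fderiv ℝ (fderiv ℝ f) z k h := by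
  have hd : DifferentiableAt ℝ (fderiv ℝ f) z :=
    ((hf.fderiv_of_isOpen (m := (⊤ : ℕ∞)) hU (by simp)).differentiableOn
      (by simp)).differentiableAt (hU.mem_nhds hz)
  rw [fderiv_clm_apply hd (differentiableAt_const h)]
  simp

lemma fderiv_fderiv_comm {f : ℂ → ℂ} {U : Set ℂ} (hU : IsOpen U)
    (hf : ContDiffOn ℝ (⊤ : ℕ∞) f U) {z : ℂ} (hz : z ∈ U) (h k : ℂ) :
    fderiv ℝ (fderiv ℝ f) z k h = fderiv ℝ (fderiv ℝ f) z h k :=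
  (hf.contDiffAt (hU.mem_nhds hz)).isSymmSndFDerivAt
    (by simp; exact WithTop.coe_le_coe.2 le_top) k h

lemma wdz1_wdzbar1_eq_laplacian {f : ℂ → ℂ} {U : Set ℂ} (hU : IsOpen U)
    (hf : ContDiffOn ℝ (⊤ : ℕ∞) f U) {z : ℂ} (hz : z ∈ U) :
    4 * wdz1 (wdzbar1 f) z = fderiv ℝ (fun z => fderiv ℝ f z 1) z 1
      + fderiv ℝ (fun z => fderiv ℝ f z I) z I := by
  have h1 := (contDiffOn_fderiv_apply hU hf 1).diffAt hU hz
  have h2 := (contDiffOn_fderiv_apply hU hf I).diffAt hU hz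
  have e : ∀ k, fderiv ℝ (wdzbar1 f) z k = (1/2 : ℂ) * (fderiv ℝ (fun z => fderiv ℝ f z 1) z k
      + I * fderiv ℝ (fun z => fderiv ℝ f z I) z k) := by
    intro k
    have := (((h1.hasFDerivAt.add (h2.hasFDerivAt.const_mul I))).const_mul (1/2 : ℂ)).fderiv
    have h3 : (fun z => (1/2 : ℂ) * (fderiv ℝ f z 1 + I * fderiv ℝ f z I)) = wdzbar1 f := rfl
    simp only [← h3]
    erw [this]
    simp
    ring
  rw [wdz1, e, e]
  simp only [fderiv_fderiv_apply hU hf hz, fderiv_fderiv_comm hU hf hz 1 I]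
  linear_combination (-fderiv ℝ (fderiv ℝ f) z I I) * I_mul_I

lemma wdzbar1_wdz1_eq_laplacian {f : ℂ → ℂ} {U : Set ℂ} (hU : IsOpen U)
    (hf : ContDiffOn ℝ (⊤ : ℕ∞) f U) {z : ℂ} (hz : z ∈ U) :
    4 * wdzbar1 (wdz1 f) z = fderiv ℝ (fun z => fderiv ℝ f z 1) z 1
      + fderiv ℝ (fun z => fderiv ℝ f z I) z I := by
  have h1 := (contDiffOn_fderiv_apply hU hf 1).diffAt hU hz
  have h2 := (contDiffOn_fderiv_apply hU hf I).diffAt hU hz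
  have e : ∀ k, fderiv ℝ (wdz1 f) z k = (1/2 : ℂ) * (fderiv ℝ (fun z => fderiv ℝ f z 1) z k
      - I * fderiv ℝ (fun z => fderiv ℝ f z I) z k) := by
    intro k
    have := (((h1.hasFDerivAt.sub (h2.hasFDerivAt.const_mul I))).const_mul (1/2 : ℂ)).fderiv
    have h3 : (fun z => (1/2 : ℂ) * (fderiv ℝ f z 1 - I * fderiv ℝ f z I)) = wdz1 f := rfl
    simp only [← h3]
    erw [this]
    simp
  rw [wdzbar1, e, e]
  simp only [fderiv_fderiv_apply hU hf hz, fderiv_fderiv_comm hU hf hz 1 I]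
  linear_combination (-fderiv ℝ (fderiv ℝ f) z I I) * I_mul_I

/-- The mixed Wirtinger derivatives commute. -/
lemma wdzbar1_wdz1_comm {f : ℂ → ℂ} {U : Set ℂ} (hU : IsOpen U)
    (hf : ContDiffOn ℝ (⊤ : ℕ∞) f U) {z : ℂ} (hz : z ∈ U) :
    wdzbar1 (wdz1 f) z = wdz1 (wdzbar1 f) z := by
  have h := (wdzbar1_wdz1_eq_laplacian hU hf hz).trans (wdz1_wdzbar1_eq_laplacian hU hf hz).symm
  exact mul_left_cancel₀ (by norm_num) h

/-- Differentiation under the integral sign for a jointly continuous derivative. -/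
lemma hasDerivAt_intervalIntegral_of_continuousOn {J : Set ℝ} (hJ : IsOpen J)
    {f f' : ℝ → ℝ → ℂ}
    (hd : ∀ r ∈ J, ∀ θ, HasDerivAt (fun s => f s θ) (f' r θ) r)
    (hc : ContinuousOn (Function.uncurry f) (J ×ˢ univ))
    (hc' : ContinuousOn (Function.uncurry f') (J ×ˢ univ)) (a b : ℝ) {r : ℝ} (hr : r ∈ J) :
    HasDerivAt (fun s => ∫ θ in a..b, f s θ) (∫ θ in a..b, f' r θ) r := by
  obtain ⟨ε, hε, hball⟩ := Metric.nhds_basis_closedBall.mem_iff.1 (hJ.mem_nhds hr)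
  have hslice : ∀ {g : ℝ → ℝ → ℂ}, ContinuousOn (Function.uncurry g) (J ×ˢ univ) →
      ∀ s ∈ J, Continuous (g s) := by
    intro g hg s hs
    have : ContinuousOn (fun θ : ℝ => Function.uncurry g (s, θ)) univ :=
      hg.comp (by fun_prop) (fun θ _ => ⟨hs, mem_univ _⟩)
    simpa [continuousOn_univ] using this
  obtain ⟨K, hK⟩ := ((isCompact_closedBall r ε).prod (isCompact_uIcc (a := a) (b := b))
    ).exists_bound_of_continuousOn (hc'.mono (prod_mono hball (subset_univ _)))
  refine (intervalIntegral.hasDerivAt_integral_of_dominated_loc_of_deriv_le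
    (bound := fun _ => K) (Metric.closedBall_mem_nhds r hε) ?_ ?_ ?_ ?_ ?_ ?_).2
  · filter_upwards [hJ.mem_nhds hr] with s hs
    exact (hslice hc s hs).aestronglyMeasurable
  · exact (hslice hc r hr).intervalIntegrable _ _
  · exact (hslice hc' r hr).aestronglyMeasurable
  · exact Eventually.of_forall fun θ hθ s hs => hK (s, θ) ⟨hs, uIoc_subset_uIcc hθ⟩
  · exact continuous_const.intervalIntegrable _ _
  · exact Eventually.of_forall fun θ _ s hs => hd s (hball hs) θ

/-- The `n`-th (unnormalised) Fourier coefficient of `f` on the circle of radius `r` about `w`. -/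
def circleMode (f : ℂ → ℂ) (w : ℂ) (n : ℤ) (r : ℝ) : ℂ :=
  ∫ θ in (0 : ℝ)..2 * Real.pi, f (w + r * exp (θ * I)) * exp (-(n * (θ * I)))

lemma norm_exp_neg_int_mul (n : ℤ) (θ : ℝ) : ‖exp (-(n * (θ * I)))‖ = 1 := by
  have : -((n : ℂ) * (θ * I)) = ((-(n * θ) : ℝ) : ℂ) * I := by push_cast; ring
  rw [this, norm_exp_ofReal_mul_I]

lemma circlePoint_mem_ball {w : ℂ} {r R : ℝ} (hr : |r| < R) (θ : ℝ) :
    w + r * exp (θ * I) ∈ ball w R := by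
  simpa [norm_exp_ofReal_mul_I] using hr

lemma norm_circleMode_le {f : ℂ → ℂ} {w : ℂ} {n : ℤ} {r B : ℝ}
    (hB : ∀ θ : ℝ, ‖f (w + r * exp (θ * I))‖ ≤ B) :
    ‖circleMode f w n r‖ ≤ 2 * Real.pi * B := by
  have := intervalIntegral.norm_integral_le_of_norm_le_const (a := 0) (b := 2 * Real.pi) (C := B)
    (f := fun θ : ℝ => f (w + r * exp (θ * I)) * exp (-(n * (θ * I)))) (by
      intro θ _
      rw [norm_mul, norm_exp_neg_int_mul, mul_one]
      exact hB θ)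
  rw [sub_zero, abs_of_pos Real.two_pi_pos] at this
  rw [circleMode]
  linarith

lemma continuousOn_circle {f : ℂ → ℂ} {w : ℂ} {R : ℝ} (hf : ContinuousOn f (ball w R)) (n : ℤ) :
    ContinuousOn (Function.uncurry fun (s θ : ℝ) =>
      f (w + s * exp (θ * I)) * exp (-(n * (θ * I)))) (Ioo (-R) R ×ˢ univ) := by
  refine ContinuousOn.mul (hf.comp (f := fun p : ℝ × ℝ => w + p.1 * exp (p.2 * I))
    (by fun_prop) ?_) (by fun_prop)
  intro p hp
  exact circlePoint_mem_ball (abs_lt.2 hp.1) _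

lemma continuous_circle {f : ℂ → ℂ} {w : ℂ} {R : ℝ} (hf : ContinuousOn f (ball w R)) (n : ℤ)
    {r : ℝ} (hr : |r| < R) :
    Continuous fun θ : ℝ => f (w + r * exp (θ * I)) * exp (-(n * (θ * I))) := by
  have : ContinuousOn (fun θ : ℝ => f (w + r * exp (θ * I)) * exp (-(n * (θ * I)))) univ :=
    (continuousOn_circle hf n).comp (f := fun θ : ℝ => (r, θ)) (by fun_prop)
      (fun θ _ => ⟨abs_lt.1 hr, mem_univ _⟩)
  simpa [continuousOn_univ] using this

lemma circleMode_sub_const {f : ℂ → ℂ} {w : ℂ} {R : ℝ} (hf : ContinuousOn f (ball w R)) {n : ℤ}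
    (hn : n ≠ 0) {r : ℝ} (hr : |r| < R) (c : ℂ) :
    circleMode (fun z => f z - c) w n r = circleMode f w n r := by
  have h0 : ∫ θ in (0 : ℝ)..2 * Real.pi, c * exp (-(n * (θ * I))) = 0 := by
    have hne : (-(n : ℂ) * I) ≠ 0 := by simp [hn]
    have := integral_exp_mul_complex (a := 0) (b := 2 * Real.pi) hne
    rw [intervalIntegral.integral_const_mul]
    have e : ∀ θ : ℝ, exp (-((n : ℂ) * (θ * I))) = exp (-(n : ℂ) * I * θ) := by
      intro θ; congr 1; ring
    simp only [e, this]
    have e2 : -(n : ℂ) * I * ((2 * Real.pi : ℝ) : ℂ) = ((-n : ℤ) : ℂ) * (2 * Real.pi * I) := by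
      push_cast; ring
    rw [e2, exp_int_mul_two_pi_mul_I]
    simp
  simp only [circleMode, sub_mul]
  rw [intervalIntegral.integral_sub, h0, sub_zero]
  · exact (continuous_circle hf n hr).intervalIntegrable _ _
  · exact Continuous.intervalIntegrable (by fun_prop) _ _

/-- Radial derivative and angular integration by parts for Fourier coefficients on circles. -/
lemma circleMode_calculus {f : ℂ → ℂ} {w : ℂ} {R : ℝ}
    (hf : ContDiffOn ℝ (⊤ : ℕ∞) f (ball w R)) (n : ℤ) {r : ℝ} (hr : |r| < R) :
    HasDerivAt (circleMode f w n)
        (circleMode (wdz1 f) w (n - 1) r + circleMode (wdzbar1 f) w (n + 1) r) r ∧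
      n * circleMode f w n r =
        r * (circleMode (wdz1 f) w (n - 1) r - circleMode (wdzbar1 f) w (n + 1) r) := by
  have hc := hf.continuousOn
  have hc1 := (contDiffOn_wdz1 isOpen_ball hf).continuousOn
  have hc2 := (contDiffOn_wdzbar1 isOpen_ball hf).continuousOn
  have i1 := (continuous_circle hc1 (n - 1) hr).intervalIntegrable (μ := MeasureTheory.volume)
    0 (2 * Real.pi)
  have i2 := (continuous_circle hc2 (n + 1) hr).intervalIntegrable (μ := MeasureTheory.volume)
    0 (2 * Real.pi)
  have hconj : ∀ θ : ℝ, (starRingEnd ℂ) (exp (θ * I)) = exp (-(θ * I)) := by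
    intro θ; rw [← exp_conj]; simp
  have ea : ∀ θ : ℝ, exp (θ * I) * exp (-(n * (θ * I))) = exp (-((n - 1 : ℤ) * (θ * I))) := by
    intro θ; rw [← exp_add]; congr 1; push_cast; ring
  have eb : ∀ θ : ℝ, exp (-(θ * I)) * exp (-(n * (θ * I))) = exp (-((n + 1 : ℤ) * (θ * I))) := by
    intro θ; rw [← exp_add]; congr 1; push_cast; ring
  constructor
  · simp only [circleMode]
    rw [← intervalIntegral.integral_add i1 i2]
    refine hasDerivAt_intervalIntegral_of_continuousOn (J := Ioo (-R) R) isOpen_Ioo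
      (f' := fun s θ => wdz1 f (w + s * exp (θ * I)) * exp (-((n - 1 : ℤ) * (θ * I)))
        + wdzbar1 f (w + s * exp (θ * I)) * exp (-((n + 1 : ℤ) * (θ * I)))) ?_
      (continuousOn_circle hc n)
      ((continuousOn_circle hc1 (n - 1)).add (continuousOn_circle hc2 (n + 1))) _ _ (abs_lt.1 hr)
    intro s hs θ
    have hγ : HasDerivAt (fun s : ℝ => w + s * exp (θ * I)) (exp (θ * I)) s := by
      simpa using ((hasDerivAt_id s).ofReal_comp.mul_const (exp (θ * I))).const_add w
    have := (hγ.wirtinger_comp (f := f)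
      (hf.diffAt isOpen_ball (circlePoint_mem_ball (abs_lt.2 hs) θ))).mul_const
        (exp (-(n * (θ * I))))
    refine this.congr_deriv ?_
    rw [← ea, ← eb, hconj]; ring
  · have hderiv : ∀ θ : ℝ, HasDerivAt
        (fun θ : ℝ => f (w + r * exp (θ * I)) * exp (-(n * (θ * I))))
        (I * (r * (wdz1 f (w + r * exp (θ * I)) * exp (-((n - 1 : ℤ) * (θ * I)))
          - wdzbar1 f (w + r * exp (θ * I)) * exp (-((n + 1 : ℤ) * (θ * I))))
          - n * (f (w + r * exp (θ * I)) * exp (-(n * (θ * I)))))) θ := by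
      intro θ
      have h1 : HasDerivAt (fun θ : ℝ => (θ : ℂ) * I) I θ := by
        simpa using (hasDerivAt_id θ).ofReal_comp.mul_const I
      have hγ : HasDerivAt (fun θ : ℝ => w + r * exp (θ * I)) (r * (exp (θ * I) * I)) θ :=
        (h1.cexp.const_mul (r : ℂ)).const_add w
      have h2 : HasDerivAt (fun θ : ℝ => exp (-(n * (θ * I))))
          (exp (-(n * (θ * I))) * -(n * I)) θ := (h1.const_mul (n : ℂ)).neg.cexp
      have := (hγ.wirtinger_comp (f := f)
        (hf.diffAt isOpen_ball (circlePoint_mem_ball hr θ))).mul h2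
      refine this.congr_deriv ?_
      rw [← ea, ← eb, map_mul, map_mul, hconj, conj_I, conj_ofReal]; ring
    have i3 := (continuous_circle hc n hr).intervalIntegrable (μ := MeasureTheory.volume)
      0 (2 * Real.pi)
    have hint := intervalIntegral.integral_eq_sub_of_hasDerivAt (a := 0) (b := 2 * Real.pi)
      (fun θ _ => hderiv θ)
      ((((i1.sub i2).const_mul (r : ℂ)).sub (i3.const_mul (n : ℂ))).const_mul I)
    rw [intervalIntegral.integral_const_mul, intervalIntegral.integral_sub
      ((i1.sub i2).const_mul (r : ℂ)) (i3.const_mul (n : ℂ)), intervalIntegral.integral_const_mul,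
      intervalIntegral.integral_const_mul, intervalIntegral.integral_sub i1 i2] at hint
    have hper : f (w + r * exp (((2 * Real.pi : ℝ) : ℂ) * I))
          * exp (-(n * (((2 * Real.pi : ℝ) : ℂ) * I)))
        - f (w + r * exp (((0 : ℝ) : ℂ) * I)) * exp (-(n * (((0 : ℝ) : ℂ) * I))) = 0 := by
      have e2 : -((n : ℂ) * (((2 * Real.pi : ℝ) : ℂ) * I))
          = ((-n : ℤ) : ℂ) * (2 * Real.pi * I) := by
        push_cast; ring
      rw [e2, exp_int_mul_two_pi_mul_I]
      push_cast
      rw [exp_two_pi_mul_I]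
      simp
    rw [hper] at hint
    have := (mul_eq_zero.1 hint).resolve_left I_ne_zero
    simp only [circleMode]
    linear_combination -this

/-- Interior Schauder estimate at the centre of the disk. -/
lemma norm_wdz1_wdz1_le {D : ℂ → ℂ} {w : ℂ} {α M H : ℝ} (hα : 0 < α)
    (hD : ContDiffOn ℝ (⊤ : ℕ∞) D (ball w 2))
    (hM : ∀ z ∈ closedBall w 1, ‖D z‖ ≤ M)
    (hH : ∀ z ∈ closedBall w 1,
      ‖wdz1 (wdzbar1 D) z - wdz1 (wdzbar1 D) w‖ ≤ H * ‖z - w‖ ^ α) :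
    ‖wdz1 (wdz1 D) w‖ ≤ 2 * M + 8 * H / α := by
  set g := wdz1 D with hg
  have hgs : ContDiffOn ℝ (⊤ : ℕ∞) g (ball w 2) := contDiffOn_wdz1 isOpen_ball hD
  set c := circleMode g w 1 with hc
  set a := circleMode D w 2 with ha
  have hpi := Real.pi_pos
  have hH0 : 0 ≤ H := by
    have := hH (w + 1) (by simp)
    simp at this
    exact (norm_nonneg _).trans this
  have hcd : ∀ r : ℝ, |r| < 2 → HasDerivAt c
      (circleMode (wdz1 g) w 0 r + circleMode (wdzbar1 g) w 2 r) r := fun r hr => by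
    simpa using (circleMode_calculus hgs 1 hr).1
  have hcr : ∀ r : ℝ, |r| < 2 → c r
      = r * (circleMode (wdz1 g) w 0 r - circleMode (wdzbar1 g) w 2 r) := fun r hr => by
    simpa using (circleMode_calculus hgs 1 hr).2
  have had : ∀ r : ℝ, |r| < 2 → HasDerivAt a
      (c r + circleMode (wdzbar1 D) w 3 r) r := fun r hr => by
    simpa using (circleMode_calculus hD 2 hr).1
  have har : ∀ r : ℝ, |r| < 2 → 2 * a r
      = r * (c r - circleMode (wdzbar1 D) w 3 r) := fun r hr => by
    simpa using (circleMode_calculus hD 2 hr).2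
  set Q : ℂ := 2 * Real.pi * wdz1 g w with hQ
  have hc0 : HasDerivAt c Q 0 := by
    have h := hcd 0 (by simp)
    have e1 : circleMode (wdz1 g) w 0 0 = Q := by
      simp [circleMode, hQ]
    have e2 : circleMode (wdzbar1 g) w 2 0 = 0 := by
      rw [← circleMode_sub_const (contDiffOn_wdzbar1 isOpen_ball hgs).continuousOn (by norm_num)
        (by simp) (wdzbar1 g w)]
      simp [circleMode]
    rwa [e1, e2, add_zero] at h
  have hm : ∀ r : ℝ, 0 ≤ r → r ≤ 1 →
      ‖circleMode (wdzbar1 g) w 2 r‖ ≤ 2 * Real.pi * (H * r ^ α) := by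
    intro r h0 h1
    rw [← circleMode_sub_const (contDiffOn_wdzbar1 isOpen_ball hgs).continuousOn (by norm_num)
        (r := r) (by rw [abs_of_nonneg h0]; linarith) (wdzbar1 g w)]
    refine norm_circleMode_le fun θ => ?_
    have hz : w + r * exp (θ * I) ∈ closedBall w 1 := by
      simpa [norm_exp_ofReal_mul_I, abs_of_nonneg h0] using h1
    have hz2 : w + r * exp (θ * I) ∈ ball w 2 :=
      circlePoint_mem_ball (by rw [abs_of_nonneg h0]; linarith) θ
    rw [wdzbar1_wdz1_comm isOpen_ball hD hz2,
      wdzbar1_wdz1_comm isOpen_ball hD (mem_ball_self (by norm_num))]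
    refine (hH _ hz).trans_eq ?_
    simp [norm_exp_ofReal_mul_I, abs_of_nonneg h0]
  have hy : ∀ r : ℝ, 0 < r → r ≤ 1 → ‖c r / r - Q‖ ≤ 4 * Real.pi * H / α := by
    intro r hr0 hr1
    have key : ∀ ε : ℝ, 0 < ε → ε < r → ‖c r / r - c ε / ε‖ ≤ 4 * Real.pi * H / α := by
      intro ε hε hεr
      have hder : ∀ s ∈ Icc ε r, HasDerivAt (fun s : ℝ => c s / s - c ε / ε)
          (2 * circleMode (wdzbar1 g) w 2 s / s) s := by
        intro s hs
        have hs0 : 0 < s := hε.trans_le hs.1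
        have hs2 : |s| < 2 := by rw [abs_of_pos hs0]; linarith [hs.2]
        have hsc : (s : ℂ) ≠ 0 := by exact_mod_cast hs0.ne'
        have := ((hcd s hs2).div (hasDerivAt_id s).ofReal_comp hsc).sub_const (c ε / ε)
        refine this.congr_deriv ?_
        rw [hcr s hs2]
        simp only [id]
        field_simp
        push_cast
        ring
      have hB : ∀ s ∈ Icc ε r, HasDerivAt (fun s : ℝ => 4 * Real.pi * H / α * s ^ α)
          (4 * Real.pi * H / α * (α * s ^ (α - 1))) s := by
        intro s hs
        exact (Real.hasDerivAt_rpow_const (Or.inl (hε.trans_le hs.1).ne')).const_mul _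
      have := image_norm_le_of_norm_deriv_right_le_deriv_boundary' (a := ε) (b := r)
        (f := fun s : ℝ => c s / s - c ε / ε)
        (fun s hs => (hder s hs).continuousAt.continuousWithinAt)
        (fun s hs => (hder s (Ico_subset_Icc_self hs)).hasDerivWithinAt)
        (B := fun s : ℝ => 4 * Real.pi * H / α * s ^ α) (by
          simp only [sub_self, norm_zero]; positivity)
        (fun s hs => (hB s hs).continuousAt.continuousWithinAt)
        (fun s hs => (hB s (Ico_subset_Icc_self hs)).hasDerivWithinAt) (by
          intro s hs
          have hs0 : 0 < s := hε.trans_le hs.1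
          rw [norm_div, norm_mul, Complex.norm_real, Real.norm_of_nonneg hs0.le,
            Real.rpow_sub hs0, Real.rpow_one, div_le_iff₀ hs0]
          have := hm s hs0.le (hs.2.le.trans hr1)
          rw [Complex.norm_ofNat]
          calc _ ≤ 2 * (2 * Real.pi * (H * s ^ α)) := by gcongr
            _ = _ := by field_simp; ring) (right_mem_Icc.2 hεr.le)
      refine this.trans ?_
      have h1 : r ^ α ≤ 1 := Real.rpow_le_one hr0.le hr1 hα.le
      have h2 : 0 ≤ 4 * Real.pi * H / α := by positivity
      exact mul_le_of_le_one_right h2 h1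
    have hlim : Tendsto (fun ε : ℝ => c ε / ε) (𝓝[>] 0) (𝓝 Q) := by
      have h1 := hc0.tendsto_slope.mono_left
        (nhdsWithin_mono 0 (fun x (hx : (0:ℝ) < x) => hx.ne'))
      refine h1.congr fun ε => ?_
      have : c 0 = 0 := by simpa using hcr 0 (by simp)
      rw [slope_def_module, this, sub_zero, sub_zero, Complex.real_smul]
      push_cast; rw [div_eq_inv_mul]
    have hlim2 := (tendsto_const_nhds (x := c r / r)).sub hlim |>.norm
    refine le_of_tendsto hlim2 ?_
    filter_upwards [Ioo_mem_nhdsGT hr0] with ε hε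
    exact key ε hε.1 hε.2
  have hz : ‖a 1 - Q / 2‖ ≤ 8 * Real.pi * H / α := by
    have hder : ∀ s ∈ Icc (0:ℝ) 1, HasDerivWithinAt
        (fun s : ℝ => (s:ℂ) ^ 2 * a s - (s:ℂ) ^ 4 * Q / 2)
        (2 * (s:ℂ) ^ 2 * c s - 2 * (s:ℂ) ^ 3 * Q) (Icc 0 1) s := by
      intro s hs
      have hs2 : |s| < 2 := by rw [abs_of_nonneg hs.1]; linarith [hs.2]
      have hid : HasDerivAt (fun s : ℝ => (s : ℂ)) 1 s := (hasDerivAt_id s).ofReal_comp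
      have := ((hid.pow 2).mul (had s hs2)).sub (((hid.pow 4).mul_const Q).div_const 2)
      refine HasDerivAt.hasDerivWithinAt ?_
      refine this.congr_deriv ?_
      have h2 := har s hs2
      simp only [Pi.pow_apply]
      push_cast
      linear_combination (s : ℂ) * h2
    have := norm_image_sub_le_of_norm_deriv_le_segment' hder
      (C := 8 * Real.pi * H / α) (by
        intro s hs
        rcases hs.1.eq_or_lt with h | h
        · rw [← h]; simp; positivity
        have hsc : (s : ℂ) ≠ 0 := by exact_mod_cast h.ne'
        have e : 2 * (s:ℂ) ^ 2 * c s - 2 * (s:ℂ) ^ 3 * Q = 2 * (s:ℂ) ^ 3 * (c s / s - Q) := by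
          field_simp
        rw [e, norm_mul, norm_mul, norm_pow, Complex.norm_real, Real.norm_of_nonneg h.le,
          Complex.norm_ofNat]
        have h1 := hy s h hs.2.le
        have h2 : s ^ 3 ≤ 1 := pow_le_one₀ h.le hs.2.le
        calc 2 * s ^ 3 * ‖c s / s - Q‖ ≤ 2 * 1 * (4 * Real.pi * H / α) := by gcongr
          _ = _ := by ring) 1 (right_mem_Icc.2 zero_le_one)
    simpa using this
  have ha1 : ‖a 1‖ ≤ 2 * Real.pi * M := norm_circleMode_le fun θ => hM _ (by
    simp [norm_exp_ofReal_mul_I])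
  have hfin : ‖Q / 2‖ ≤ 2 * Real.pi * M + 8 * Real.pi * H / α := by
    calc ‖Q / 2‖ = ‖a 1 - (a 1 - Q / 2)‖ := by rw [sub_sub_cancel]
      _ ≤ _ := (norm_sub_le _ _).trans (add_le_add ha1 hz)
  have hQ2 : ‖Q / 2‖ = Real.pi * ‖wdz1 g w‖ := by
    rw [hQ]; simp [abs_of_pos hpi]; ring
  rw [hQ2] at hfin
  have : Real.pi * ‖wdz1 g w‖ ≤ Real.pi * (2 * M + 8 * H / α) := by
    calc _ ≤ _ := hfin
      _ = _ := by ring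
  exact le_of_mul_le_mul_left this hpi

/-- Second-derivative test: at a local maximum the second derivative is nonpositive. -/
lemma IsLocalMax.second_deriv_nonpos {f f' : ℝ → ℝ} {f'' x : ℝ} (hmax : IsLocalMax f x)
    (hf : ∀ᶠ s in 𝓝 x, HasDerivAt f (f' s) s) (hf' : HasDerivAt f' f'' x) : f'' ≤ 0 := by
  by_contra! hpos
  have hd : deriv f =ᶠ[𝓝 x] f' := hf.mono fun s hs => hs.deriv
  have hmin : IsLocalMin f x := by
    refine isLocalMin_of_deriv_deriv_pos ?_ hmax.deriv_eq_zero hf.self_of_nhds.continuousAt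
    rw [hd.deriv_eq, hf'.deriv]
    exact hpos
  have hconst : f =ᶠ[𝓝 x] fun _ => f x := by
    filter_upwards [hmax, hmin] with s h1 h2 using le_antisymm h1 h2
  have hzero : f' =ᶠ[𝓝 x] fun _ => 0 := by
    filter_upwards [hconst.eventuallyEq_nhds, hf] with s h1 h2
    rw [← h2.deriv, h1.deriv_eq, deriv_const]
  have : f'' = 0 := by
    rw [← hf'.deriv, hzero.deriv_eq, deriv_const]
  exact hpos.ne' this

/-- Barrier estimate on a half-strip of width `π`: a bounded function, nonpositive on the two
horizontal sides, whose Laplacian is at least `-N exp (γ t)` with `γ < 1`, is `O(exp (γ t))`. -/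
lemma exists_halfStrip_bound {γ : ℝ} (hγ : 0 < γ) (hγ1 : γ < 1) {M N : ℝ} (hM : 0 ≤ M)
    (hN : 0 ≤ N) :
    ∃ A : ℝ, 0 ≤ A ∧ ∀ (φ : ℝ) (d dt dtt dθ dθθ : ℝ → ℝ → ℝ),
      (∀ t < 0, ∀ θ, HasDerivAt (fun s => d s θ) (dt t θ) t) →
      (∀ t < 0, ∀ θ, HasDerivAt (fun s => dt s θ) (dtt t θ) t) →
      (∀ t < 0, ∀ θ, HasDerivAt (fun s => d t s) (dθ t θ) θ) →
      (∀ t < 0, ∀ θ, HasDerivAt (fun s => dθ t s) (dθθ t θ) θ) →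
      ContinuousOn (Function.uncurry d) (Iio 0 ×ˢ univ) →
      (∀ t < 0, ∀ θ, d t θ ≤ M) →
      (∀ t < 0, d t φ ≤ 0) → (∀ t < 0, d t (φ + Real.pi) ≤ 0) →
      (∀ t < 0, ∀ θ, -(N * Real.exp (γ * t)) ≤ dtt t θ + dθθ t θ) →
      ∀ t ≤ -1, ∀ θ ∈ Icc φ (φ + Real.pi), d t θ ≤ A * Real.exp (γ * t) := by
  obtain ⟨δ, hγδ, hδ1⟩ := exists_between hγ1
  have hpi := Real.pi_pos
  have hδ0 : 0 < δ := hγ.trans hγδ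
  set c₀ := Real.cos (δ * (Real.pi / 2)) with hc₀
  have hc₀pos : 0 < c₀ := Real.cos_pos_of_mem_Ioo ⟨by nlinarith, by nlinarith⟩
  have hgap : 0 < δ ^ 2 - γ ^ 2 := by nlinarith
  set A := (M + 1) * Real.exp γ / c₀ + (N + 1) / ((δ ^ 2 - γ ^ 2) * c₀) with hA
  have hA0 : 0 ≤ A := by positivity
  have hA1 : M < A * Real.exp (-γ) * c₀ := by
    have h1 : (M + 1) * Real.exp γ / c₀ ≤ A := le_add_of_nonneg_right (by positivity)
    have h2 : (M + 1) * Real.exp γ / c₀ * Real.exp (-γ) * c₀ = M + 1 := by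
      rw [Real.exp_neg]; field_simp
    have : (M + 1) * Real.exp γ / c₀ * Real.exp (-γ) * c₀ ≤ A * Real.exp (-γ) * c₀ := by gcongr
    linarith
  have hA2 : N < (δ ^ 2 - γ ^ 2) * (A * c₀) := by
    have h1 : (N + 1) / ((δ ^ 2 - γ ^ 2) * c₀) ≤ A := le_add_of_nonneg_left (by positivity)
    have h2 : (δ ^ 2 - γ ^ 2) * ((N + 1) / ((δ ^ 2 - γ ^ 2) * c₀) * c₀) = N + 1 := by
      field_simp
    have : (δ ^ 2 - γ ^ 2) * ((N + 1) / ((δ ^ 2 - γ ^ 2) * c₀) * c₀)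
      ≤ (δ ^ 2 - γ ^ 2) * (A * c₀) := by gcongr
    linarith
  refine ⟨A, hA0, ?_⟩
  intro φ d dt dtt dθ dθθ h1 h2 h3 h4 hcont hdM hl hr hlap t₀ ht₀ θ₀ hθ₀
  set κ : ℝ → ℝ := fun θ => Real.cos (δ * (θ - φ - Real.pi / 2)) with hκ
  have hκlow : ∀ θ ∈ Icc φ (φ + Real.pi), c₀ ≤ κ θ := by
    intro θ hθ
    rw [hκ, hc₀]
    simp only
    rw [← Real.cos_abs (δ * (θ - φ - Real.pi / 2))]
    refine Real.cos_le_cos_of_nonneg_of_le_pi (abs_nonneg _) (by nlinarith) ?_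
    rw [abs_mul, abs_of_pos hδ0]
    gcongr
    rw [abs_le]
    constructor <;> linarith [hθ.1, hθ.2]
  have main : ∀ ε > 0,
      d t₀ θ₀ ≤ (A * Real.exp (γ * t₀) + ε * Real.exp (-γ * t₀)) * κ θ₀ := by
    intro ε hε
    set e : ℝ → ℝ := fun t => A * Real.exp (γ * t) + ε * Real.exp (-γ * t) with he
    have he0 : ∀ t, 0 < e t := fun t => by positivity
    by_contra! hlt
    change e t₀ * κ θ₀ < _ at hlt
    set T := min (t₀ - 1) (-(M / (ε * c₀)) / γ) with hT
    have hTt : T < t₀ := (min_le_left _ _).trans_lt (by linarith)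
    have hTM : M < ε * Real.exp (-γ * T) * c₀ := by
      have : M / (ε * c₀) ≤ -γ * T := by
        have := min_le_right (t₀ - 1) (-(M / (ε * c₀)) / γ)
        rw [← hT, le_div_iff₀ hγ] at this
        linarith
      have h5 := Real.add_one_le_exp (-γ * T)
      have h6 : M / (ε * c₀) < Real.exp (-γ * T) := by linarith
      rw [div_lt_iff₀ (by positivity)] at h6
      linarith
    set K := Icc T (-1) ×ˢ Icc φ (φ + Real.pi) with hK
    have hKc : IsCompact K := isCompact_Icc.prod isCompact_Icc
    have hmem : (t₀, θ₀) ∈ K := ⟨⟨hTt.le, ht₀⟩, hθ₀⟩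
    have hcontH : ContinuousOn (fun p : ℝ × ℝ => d p.1 p.2 - e p.1 * κ p.2) K := by
      refine ContinuousOn.sub (hcont.mono ?_) ?_
      · rintro p hp
        exact ⟨lt_of_le_of_lt hp.1.2 (by norm_num), mem_univ _⟩
      · exact Continuous.continuousOn (by fun_prop)
    obtain ⟨⟨a, b⟩, ⟨ha, hb⟩, hmax⟩ := hKc.exists_isMaxOn ⟨_, hmem⟩ hcontH
    simp only at ha hb
    have hpos : e a * κ b < d a b := by
      have := hmax hmem
      simp only [mem_ofPred_eq] at this
      linarith
    have ha0 : a < 0 := lt_of_le_of_lt ha.2 (by norm_num)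
    have hκb := hκlow b hb
    have haT : T < a := by
      refine ha.1.lt_of_ne ?_
      rintro rfl
      have h5 := hdM T ha0 b
      have : ε * Real.exp (-γ * T) * c₀ ≤ e T * κ b := by
        have : ε * Real.exp (-γ * T) ≤ e T := le_add_of_nonneg_left (by positivity)
        have := he0 T
        gcongr
      linarith
    have ha1 : a < -1 := by
      refine ha.2.lt_of_ne ?_
      rintro rfl
      have h5 := hdM (-1) ha0 b
      have : A * Real.exp (-γ) * c₀ ≤ e (-1) * κ b := by
        have : A * Real.exp (-γ) ≤ e (-1) := by
          simp only [he, mul_neg, mul_one]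
          exact le_add_of_nonneg_right (by positivity)
        have := he0 (-1)
        gcongr
      linarith
    have hprod : 0 < e a * κ b := mul_pos (he0 a) (hc₀pos.trans_le hκb)
    have hb1 : φ < b := by
      refine hb.1.lt_of_ne ?_
      rintro rfl
      linarith [hl a ha0]
    have hb2 : b < φ + Real.pi := by
      refine hb.2.lt_of_ne ?_
      rintro rfl
      linarith [hr a ha0]
    have het : ∀ t, HasDerivAt e
        (A * (Real.exp (γ * t) * γ) + ε * (Real.exp (-γ * t) * -γ)) t := by
      intro t
      have e1 : HasDerivAt (fun t => γ * t) γ t := by simpa using (hasDerivAt_id t).const_mul γ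
      have e2 : HasDerivAt (fun t => -γ * t) (-γ) t := by
        simpa using (hasDerivAt_id t).const_mul (-γ)
      exact (e1.exp.const_mul A).add (e2.exp.const_mul ε)
    have hett : ∀ t, HasDerivAt
        (fun t => A * (Real.exp (γ * t) * γ) + ε * (Real.exp (-γ * t) * -γ)) (γ ^ 2 * e t) t := by
      intro t
      have e1 : HasDerivAt (fun t => γ * t) γ t := by simpa using (hasDerivAt_id t).const_mul γ
      have e2 : HasDerivAt (fun t => -γ * t) (-γ) t := by
        simpa using (hasDerivAt_id t).const_mul (-γ)
      refine (((e1.exp.mul_const γ).const_mul A).add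
        ((e2.exp.mul_const (-γ)).const_mul ε)).congr_deriv ?_
      simp only [he]; ring
    have hlin : ∀ θ, HasDerivAt (fun θ => δ * (θ - φ - Real.pi / 2)) δ θ := by
      intro θ
      simpa using (((hasDerivAt_id θ).sub_const φ).sub_const (Real.pi / 2)).const_mul δ
    have hκ1 : ∀ θ, HasDerivAt κ (-Real.sin (δ * (θ - φ - Real.pi / 2)) * δ) θ :=
      fun θ => (hlin θ).cos
    have hκ2 : ∀ θ, HasDerivAt (fun θ => -Real.sin (δ * (θ - φ - Real.pi / 2)) * δ)
        (-δ ^ 2 * κ θ) θ := by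
      intro θ
      refine ((hlin θ).sin.neg.mul_const δ).congr_deriv ?_
      simp only [hκ]; ring
    have hT2 : dtt a b - γ ^ 2 * e a * κ b ≤ 0 := by
      refine IsLocalMax.second_deriv_nonpos (f := fun s => d s b - e s * κ b)
        (f' := fun s => dt s b
          - (A * (Real.exp (γ * s) * γ) + ε * (Real.exp (-γ * s) * -γ)) * κ b) (x := a) ?_ ?_ ?_
      · filter_upwards [Icc_mem_nhds haT ha1] with s hs using hmax (⟨hs, hb⟩ : (s, b) ∈ K)
      · filter_upwards [Iio_mem_nhds ha0] with s hs
        exact (h1 s hs b).sub ((het s).mul_const _)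
      · exact (h2 a ha0 b).sub ((hett a).mul_const _)
    have hθ2 : dθθ a b - e a * (-δ ^ 2 * κ b) ≤ 0 := by
      refine IsLocalMax.second_deriv_nonpos (f := fun s => d a s - e a * κ s)
        (f' := fun s => dθ a s - e a * (-Real.sin (δ * (s - φ - Real.pi / 2)) * δ))
        (x := b) ?_ ?_ ?_
      · filter_upwards [Icc_mem_nhds hb1 hb2] with s hs using hmax (⟨ha, hs⟩ : (a, s) ∈ K)
      · exact Eventually.of_forall fun s => (h3 a ha0 s).sub ((hκ1 s).const_mul _)
      · exact (h4 a ha0 b).sub ((hκ2 b).const_mul _)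
    have h5 := hlap a ha0 b
    have h6 : A * Real.exp (γ * a) * c₀ ≤ e a * κ b := by
      have : A * Real.exp (γ * a) ≤ e a := le_add_of_nonneg_right (by positivity)
      have := he0 a
      gcongr
    have h7 : (δ ^ 2 - γ ^ 2) * (A * Real.exp (γ * a) * c₀) ≤ (δ ^ 2 - γ ^ 2) * (e a * κ b) := by
      gcongr
    have h8 : N * Real.exp (γ * a) < (δ ^ 2 - γ ^ 2) * (A * c₀) * Real.exp (γ * a) := by
      gcongr
    nlinarith
  have hlim : Tendsto (fun ε : ℝ => (A * Real.exp (γ * t₀) + ε * Real.exp (-γ * t₀)) * κ θ₀)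
      (𝓝[>] 0) (𝓝 ((A * Real.exp (γ * t₀) + 0 * Real.exp (-γ * t₀)) * κ θ₀)) :=
    tendsto_nhdsWithin_of_tendsto_nhds (Continuous.tendsto (by fun_prop) 0)
  have hle := ge_of_tendsto hlim (eventually_nhdsWithin_of_forall main)
  refine hle.trans ?_
  rw [zero_mul, add_zero]
  exact mul_le_of_le_one_right (by positivity) (Real.cos_le_one _)

lemma norm_le_of_forall_re_mul_le {z : ℂ} {A : ℝ} (h : ∀ c : ℂ, ‖c‖ ≤ 1 → (c * z).re ≤ A) :
    ‖z‖ ≤ A := by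
  have h1 := h ((starRingEnd ℂ) z / ‖z‖) (by
    rw [norm_div, RCLike.norm_conj, Complex.norm_real, norm_norm]; exact div_self_le_one _)
  have h2 : (starRingEnd ℂ) z / ‖z‖ * z = (‖z‖ : ℂ) := by
    rcases eq_or_ne z 0 with rfl | hz
    · simp
    · have : (‖z‖ : ℂ) ≠ 0 := by simpa using hz
      rw [div_mul_eq_mul_div, conj_mul']
      field_simp
  rwa [h2, ofReal_re] at h1

lemma isOpen_re_neg : IsOpen {w : ℂ | w.re < 0} := isOpen_lt continuous_re continuous_const

/-- Exponential decay of the oscillation in the angular direction. -/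
lemma exists_norm_sub_translate_le {γ : ℝ} (hγ : 0 < γ) (hγ1 : γ < 1) {W : ℂ → ℂ} {M N : ℝ}
    (hN : 0 ≤ N)
    (hW : ContDiffOn ℝ (⊤ : ℕ∞) W {w | w.re < 0})
    (hper : ∀ w, W (w + 2 * Real.pi * I) = W w)
    (hM : ∀ w : ℂ, w.re < 0 → ‖W w‖ ≤ M)
    (hF : ∀ w : ℂ, w.re < 0 → ‖wdz1 (wdzbar1 W) w‖ ≤ N * Real.exp (γ * w.re)) :
    ∃ A : ℝ, 0 ≤ A ∧ ∀ w : ℂ, w.re ≤ -1 → ∀ h ∈ Icc (0 : ℝ) (2 * Real.pi),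
      ‖W w - W (w - h * I)‖ ≤ A * Real.exp (γ * w.re) := by
  have hM0 : 0 ≤ M := (norm_nonneg _).trans (hM (-1) (by simp))
  obtain ⟨A, hA0, hA⟩ := exists_halfStrip_bound hγ hγ1 (M := 2 * M) (N := 8 * N)
    (by positivity) (by positivity)
  refine ⟨A, hA0, fun w hw h hh => norm_le_of_forall_re_mul_le fun c hc => ?_⟩
  have hopen := isOpen_re_neg
  set φ := w.im - h / 2 with hφ
  set p : ℝ → ℝ → ℂ := fun t θ => t + θ * I with hp
  set q : ℝ → ℝ → ℂ := fun t θ => t + ((2 * φ - θ : ℝ) : ℂ) * I with hq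
  have hpr : ∀ t θ, (p t θ).re = t := fun t θ => by simp [hp]
  have hqr : ∀ t θ, (q t θ).re = t := fun t θ => by simp [hq]
  have hpt : ∀ t θ, HasDerivAt (fun s => p s θ) 1 t := fun t θ => by
    simpa [hp] using (hasDerivAt_id t).ofReal_comp.add_const (θ * I)
  have hqt : ∀ t θ, HasDerivAt (fun s => q s θ) 1 t := fun t θ => by
    refine ((hasDerivAt_id t).ofReal_comp.add_const
      (((2 * φ - θ : ℝ) : ℂ) * I)).congr_deriv ?_
    simp
  have hpθ : ∀ t θ, HasDerivAt (fun s => p t s) I θ := fun t θ => by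
    simpa [hp] using ((hasDerivAt_id θ).ofReal_comp.mul_const I).const_add (t : ℂ)
  have hqθ : ∀ t θ, HasDerivAt (fun s => q t s) (-I) θ := fun t θ => by
    refine (((((hasDerivAt_id θ).const_sub (2 * φ)).ofReal_comp).mul_const I).const_add
      (t : ℂ)).congr_deriv ?_
    simp
  have comp : ∀ {g : ℂ → ℂ} (_ : ContDiffOn ℝ (⊤ : ℕ∞) g {w | w.re < 0}) {k : ℝ → ℂ} {k' : ℂ}
      {s : ℝ}, (k s).re < 0 → HasDerivAt k k' s →
      HasDerivAt (fun s => g (k s)) (fderiv ℝ g (k s) k') s := by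
    intro g hg k k' s hs hk
    exact (hg.diffAt hopen hs).hasFDerivAt.comp_hasDerivAt s hk
  have reDer : ∀ {k : ℝ → ℂ} {k' : ℂ} {s : ℝ}, HasDerivAt k k' s →
      HasDerivAt (fun s => (c * k s).re) (c * k').re s := by
    intro k k' s hk
    exact reCLM.hasFDerivAt.comp_hasDerivAt s (hk.const_mul c)
  have hW1 := contDiffOn_fderiv_apply hopen hW 1
  have hWI := contDiffOn_fderiv_apply hopen hW I
  have reBound : ∀ z : ℂ, |(c * z).re| ≤ ‖z‖ := fun z => by
    refine (abs_re_le_norm _).trans ?_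
    rw [norm_mul]
    exact mul_le_of_le_one_left (norm_nonneg _) hc
  have key := hA φ (fun t θ => (c * (W (p t θ) - W (q t θ))).re)
    (fun t θ => (c * (fderiv ℝ W (p t θ) 1 - fderiv ℝ W (q t θ) 1)).re)
    (fun t θ => (c * (fderiv ℝ (fun z => fderiv ℝ W z 1) (p t θ) 1
      - fderiv ℝ (fun z => fderiv ℝ W z 1) (q t θ) 1)).re)
    (fun t θ => (c * (fderiv ℝ W (p t θ) I + fderiv ℝ W (q t θ) I)).re)
    (fun t θ => (c * (fderiv ℝ (fun z => fderiv ℝ W z I) (p t θ) I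
      - fderiv ℝ (fun z => fderiv ℝ W z I) (q t θ) I)).re)
    (fun t ht θ => reDer ((comp hW (by rwa [hpr]) (hpt t θ)).sub
      (comp hW (by rwa [hqr]) (hqt t θ))))
    (fun t ht θ => reDer ((comp hW1 (by rwa [hpr]) (hpt t θ)).sub
      (comp hW1 (by rwa [hqr]) (hqt t θ))))
    (fun t ht θ => reDer (((comp hW (by rwa [hpr]) (hpθ t θ)).sub
      (comp hW (by rwa [hqr]) (hqθ t θ))).congr_deriv (by simp)))
    (fun t ht θ => reDer (((comp hWI (by rwa [hpr]) (hpθ t θ)).add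
      (comp hWI (by rwa [hqr]) (hqθ t θ))).congr_deriv (by simp [sub_eq_add_neg])))
    ?_ ?_ ?_ ?_ ?_ w.re hw w.im ⟨by rw [hφ]; linarith [hh.1], by rw [hφ]; linarith [hh.2]⟩
  · convert key using 5
    · simp [hp, re_add_im]
    · apply Complex.ext <;> simp [hq, hφ]; ring
  · have hc1 : ContinuousOn (fun x : ℝ × ℝ => W (p x.1 x.2)) (Iio 0 ×ˢ univ) :=
      hW.continuousOn.comp (by simp only [hp]; fun_prop) fun x hx => by
        simpa [hpr] using hx.1
    have hc2 : ContinuousOn (fun x : ℝ × ℝ => W (q x.1 x.2)) (Iio 0 ×ˢ univ) :=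
      hW.continuousOn.comp (by simp only [hq]; fun_prop) fun x hx => by
        simpa only [mem_ofPred_eq, hqr] using mem_Iio.1 hx.1
    exact continuous_re.comp_continuousOn (continuousOn_const.mul (hc1.sub hc2))
  · intro t ht θ
    refine ((le_abs_self _).trans (reBound _)).trans ((norm_sub_le _ _).trans ?_)
    have h1 := hM (p t θ) (by rwa [hpr])
    have h2 := hM (q t θ) (by rwa [hqr])
    linarith
  · intro t _
    have : q t φ = p t φ := by simp only [hp, hq]; push_cast; ring
    simp [this]
  · intro t _
    have : p t (φ + Real.pi) = q t (φ + Real.pi) + 2 * Real.pi * I := by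
      simp only [hp, hq]; push_cast; ring
    simp [this, hper]
  · intro t ht θ
    have hp0 : p t θ ∈ {w : ℂ | w.re < 0} := by simpa only [mem_ofPred_eq, hpr] using ht
    have hq0 : q t θ ∈ {w : ℂ | w.re < 0} := by simpa only [mem_ofPred_eq, hqr] using ht
    have e : (c * (fderiv ℝ (fun z => fderiv ℝ W z 1) (p t θ) 1
          - fderiv ℝ (fun z => fderiv ℝ W z 1) (q t θ) 1)).re
        + (c * (fderiv ℝ (fun z => fderiv ℝ W z I) (p t θ) I
          - fderiv ℝ (fun z => fderiv ℝ W z I) (q t θ) I)).re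
        = (c * (4 * wdz1 (wdzbar1 W) (p t θ) - 4 * wdz1 (wdzbar1 W) (q t θ))).re := by
      rw [wdz1_wdzbar1_eq_laplacian hopen hW hp0, wdz1_wdzbar1_eq_laplacian hopen hW hq0,
        ← add_re]
      congr 1; ring
    simp only [e]
    have h1 := hF _ hp0
    have h2 := hF _ hq0
    rw [hpr] at h1
    rw [hqr] at h2
    have h3 := (reBound (4 * wdz1 (wdzbar1 W) (p t θ) - 4 * wdz1 (wdzbar1 W) (q t θ))).trans
      (norm_sub_le _ _)
    rw [norm_mul, norm_mul, Complex.norm_ofNat] at h3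
    have h4 := neg_le_of_abs_le h3
    linarith

lemma wdz1_sub_translate {f : ℂ → ℂ} {z a : ℂ} (h1 : DifferentiableAt ℝ f z)
    (h2 : DifferentiableAt ℝ f (z - a)) :
    wdz1 (fun z => f z - f (z - a)) z = wdz1 f z - wdz1 f (z - a) := by
  have h3 : HasFDerivAt (fun z => f (z - a)) (fderiv ℝ f (z - a)) z :=
    (hasFDerivAt_comp_sub a).2 h2.hasFDerivAt
  have := (h1.hasFDerivAt.sub h3).wdz1_eq (a := wdz1 f z - wdz1 f (z - a))
    (b := wdzbar1 f z - wdzbar1 f (z - a)) (by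
      intro h
      rw [sub_apply, fderiv_apply_eq_wirtinger, fderiv_apply_eq_wirtinger]
      ring)
  exact this

lemma wdzbar1_sub_translate {f : ℂ → ℂ} {z a : ℂ} (h1 : DifferentiableAt ℝ f z)
    (h2 : DifferentiableAt ℝ f (z - a)) :
    wdzbar1 (fun z => f z - f (z - a)) z = wdzbar1 f z - wdzbar1 f (z - a) := by
  have h3 : HasFDerivAt (fun z => f (z - a)) (fderiv ℝ f (z - a)) z :=
    (hasFDerivAt_comp_sub a).2 h2.hasFDerivAt
  have := (h1.hasFDerivAt.sub h3).wdzbar1_eq (a := wdz1 f z - wdz1 f (z - a))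
    (b := wdzbar1 f z - wdzbar1 f (z - a)) (by
      intro h
      rw [sub_apply, fderiv_apply_eq_wirtinger, fderiv_apply_eq_wirtinger]
      ring)
  exact this

lemma wdz1_periodic {f : ℂ → ℂ} {a : ℂ} (h : ∀ w, f (w + a) = f w) (w : ℂ) :
    wdz1 f (w + a) = wdz1 f w := by
  have : fderiv ℝ f (w + a) = fderiv ℝ f w := by
    rw [← fderiv_comp_add_right, funext h]
  rw [wdz1, wdz1, this]

/-- The angular oscillation of the second derivative decays exponentially. -/
lemma exists_norm_wdz1_wdz1_sub_translate_le {γ α : ℝ} (hγ : 0 < γ) (hγ1 : γ < 1) (hα : 0 < α)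
    {W : ℂ → ℂ} {M N : ℝ} (hN : 0 ≤ N)
    (hW : ContDiffOn ℝ (⊤ : ℕ∞) W {w | w.re < 0})
    (hper : ∀ w, W (w + 2 * Real.pi * I) = W w)
    (hM : ∀ w : ℂ, w.re < 0 → ‖W w‖ ≤ M)
    (hF : ∀ w : ℂ, w.re < 0 → ‖wdz1 (wdzbar1 W) w‖ ≤ N * Real.exp (γ * w.re))
    (hH : ∀ w z : ℂ, w.re < -2 → ‖z - w‖ ≤ 1 →
      ‖wdz1 (wdzbar1 W) z - wdz1 (wdzbar1 W) w‖ ≤ N * Real.exp (γ * w.re) * ‖z - w‖ ^ α) :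
    ∃ C : ℝ, 0 ≤ C ∧ ∀ w : ℂ, w.re < -2 → ∀ h ∈ Icc (0 : ℝ) (2 * Real.pi),
      ‖wdz1 (wdz1 W) w - wdz1 (wdz1 W) (w - h * I)‖ ≤ C * Real.exp (γ * w.re) := by
  obtain ⟨A, hA0, hA⟩ := exists_norm_sub_translate_le hγ hγ1 hN hW hper hM hF
  refine ⟨2 * (A * Real.exp γ) + 8 * (2 * N) / α, by positivity, fun w hw h hh => ?_⟩
  have hopen := isOpen_re_neg
  set a : ℂ := h * I with ha
  have hare : ∀ z : ℂ, (z - a).re = z.re := fun z => by simp [ha]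
  have hmem : ∀ {z : ℂ}, z.re < 0 → z - a ∈ {w : ℂ | w.re < 0} := fun {z} hz => by
    simpa only [mem_ofPred_eq, hare] using hz
  have hball : ball w 2 ⊆ {w : ℂ | w.re < 0} := fun z hz => by
    have h1 := (abs_re_le_norm (z - w)).trans_lt (mem_ball_iff_norm.1 hz)
    rw [sub_re, abs_lt] at h1
    simp only [mem_ofPred_eq]
    linarith [h1.2]
  have hW1 := contDiffOn_wdz1 hopen hW
  have hWb := contDiffOn_wdzbar1 hopen hW
  have second : ∀ z : ℂ, z.re < 0 → wdz1 (wdz1 fun z => W z - W (z - a)) z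
      = wdz1 (wdz1 W) z - wdz1 (wdz1 W) (z - a) := fun z hz => by
    rw [← wdz1_sub_translate (hW1.diffAt hopen hz) (hW1.diffAt hopen (hmem hz))]
    refine wdz1_congr ?_
    filter_upwards [hopen.mem_nhds hz] with y hy
    exact wdz1_sub_translate (hW.diffAt hopen hy) (hW.diffAt hopen (hmem hy))
  have mixed : ∀ z : ℂ, z.re < 0 → wdz1 (wdzbar1 fun z => W z - W (z - a)) z
      = wdz1 (wdzbar1 W) z - wdz1 (wdzbar1 W) (z - a) := fun z hz => by
    rw [← wdz1_sub_translate (hWb.diffAt hopen hz) (hWb.diffAt hopen (hmem hz))]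
    refine wdz1_congr ?_
    filter_upwards [hopen.mem_nhds hz] with y hy
    exact wdzbar1_sub_translate (hW.diffAt hopen hy) (hW.diffAt hopen (hmem hy))
  rw [← second w (by linarith)]
  have hDs : ContDiffOn ℝ (⊤ : ℕ∞) (fun z => W z - W (z - a)) (ball w 2) :=
    (hW.mono hball).sub (hW.comp (contDiff_id.sub contDiff_const).contDiffOn
      fun z hz => hmem (hball hz))
  have := norm_wdz1_wdz1_le (D := fun z => W z - W (z - a)) (w := w)
    (M := A * Real.exp γ * Real.exp (γ * w.re)) (H := 2 * N * Real.exp (γ * w.re)) hα hDs ?_ ?_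
  · refine this.trans_eq ?_
    ring
  · intro z hz
    have h1 := (le_abs_self _).trans ((abs_re_le_norm (z - w)).trans (mem_closedBall_iff_norm.1 hz))
    rw [sub_re] at h1
    refine (hA z (by linarith) h hh).trans ?_
    rw [mul_assoc, ← Real.exp_add]
    gcongr
    nlinarith
  · intro z hz
    have hz1 := mem_closedBall_iff_norm.1 hz
    rw [mixed z (hball (closedBall_subset_ball (by norm_num) hz)), mixed w (by linarith)]
    have h1 := hH w z hw hz1
    have h2 := hH (w - a) (z - a) (by rwa [hare]) (by simpa using hz1)
    rw [hare, sub_sub_sub_cancel_right] at h2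
    calc _ = ‖(wdz1 (wdzbar1 W) z - wdz1 (wdzbar1 W) w)
          - (wdz1 (wdzbar1 W) (z - a) - wdz1 (wdzbar1 W) (w - a))‖ := by congr 1; ring
      _ ≤ _ := (norm_sub_le _ _).trans (add_le_add h1 h2)
      _ = _ := by ring

/-- Derivative estimates on the half-plane for bounded `2πi`-periodic solutions of the Poisson
equation with exponentially decaying Hölder right-hand side. -/
lemma exists_norm_wdz1_le {γ α : ℝ} (hγ : 0 < γ) (hγ1 : γ < 1) (hα : 0 < α)
    {W : ℂ → ℂ} {M N : ℝ} (hN : 0 ≤ N)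
    (hW : ContDiffOn ℝ (⊤ : ℕ∞) W {w | w.re < 0})
    (hper : ∀ w, W (w + 2 * Real.pi * I) = W w)
    (hM : ∀ w : ℂ, w.re < 0 → ‖W w‖ ≤ M)
    (hF : ∀ w : ℂ, w.re < 0 → ‖wdz1 (wdzbar1 W) w‖ ≤ N * Real.exp (γ * w.re))
    (hH : ∀ w z : ℂ, w.re < -2 → ‖z - w‖ ≤ 1 →
      ‖wdz1 (wdzbar1 W) z - wdz1 (wdzbar1 W) w‖ ≤ N * Real.exp (γ * w.re) * ‖z - w‖ ^ α) :
    ∃ C : ℝ, 0 ≤ C ∧ ∀ w : ℂ, w.re < -2 → ‖wdz1 W w‖ ≤ C * Real.exp (γ * w.re) ∧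
      ‖wdz1 (wdz1 W) w‖ ≤ C * Real.exp (γ * w.re) := by
  obtain ⟨C₁, hC₁0, hC₁⟩ :=
    exists_norm_wdz1_wdz1_sub_translate_le hγ hγ1 hα hN hW hper hM hF hH
  have hopen := isOpen_re_neg
  have hpi := Real.pi_pos
  have hM0 : 0 ≤ M := (norm_nonneg _).trans (hM (-1) (by simp))
  set g := wdz1 W with hg
  have hgs : ContDiffOn ℝ (⊤ : ℕ∞) g {w | w.re < 0} := contDiffOn_wdz1 hopen hW
  have hgF : ∀ w : ℂ, w.re < 0 → wdzbar1 g w = wdz1 (wdzbar1 W) w :=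
    fun w hw => wdzbar1_wdz1_comm hopen hW hw
  have hgper : ∀ w : ℂ, g (w - ((2 * Real.pi : ℝ) : ℂ) * I) = g w := fun w => by
    have := wdz1_periodic hper (w - ((2 * Real.pi : ℝ) : ℂ) * I)
    rw [← hg] at this
    rw [← this]
    congr 1; push_cast; ring
  have hre : ∀ (w : ℂ) (h : ℝ), (w - h * I).re = w.re := fun w h => by simp
  have lineI : ∀ (w : ℂ) (h : ℝ), HasDerivAt (fun h : ℝ => w - h * I) (-I) h := fun w h => by
    simpa using ((hasDerivAt_id h).ofReal_comp.mul_const I).const_sub w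
  have derI : ∀ {f : ℂ → ℂ}, ContDiffOn ℝ (⊤ : ℕ∞) f {w | w.re < 0} → ∀ (w : ℂ) (h : ℝ),
      w.re < 0 → HasDerivAt (fun h : ℝ => f (w - h * I)) (-fderiv ℝ f (w - h * I) I) h := by
    intro f hf w h hw
    refine ((hf.diffAt hopen (z := w - h * I)
      (by simpa only [mem_ofPred_eq, hre] using hw)).hasFDerivAt.comp_hasDerivAt h
        (lineI w h)).congr_deriv ?_
    simp
  have hang : ∀ w : ℂ, w.re < -2 →
      ‖fderiv ℝ g w I‖ ≤ (C₁ + 2 * N) * Real.exp (γ * w.re) := by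
    intro w hw
    have hw0 : w.re < 0 := by linarith
    have hosc : ∀ h ∈ Icc (0 : ℝ) (2 * Real.pi),
        ‖fderiv ℝ g w I - fderiv ℝ g (w - h * I) I‖ ≤ (C₁ + 2 * N) * Real.exp (γ * w.re) := by
      intro h hh
      have hwh : (w - h * I).re < 0 := by rwa [hre]
      rw [fderiv_I_eq, fderiv_I_eq, hgF w hw0, hgF _ hwh, ← mul_sub, norm_mul, norm_I, one_mul]
      have h1 := hC₁ w hw h hh
      have h2 := hF w hw0
      have h3 := hF _ hwh
      rw [hre] at h3
      calc _ = ‖(wdz1 g w - wdz1 g (w - h * I)) - wdz1 (wdzbar1 W) w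
            + wdz1 (wdzbar1 W) (w - h * I)‖ := by congr 1; ring
        _ ≤ ‖wdz1 g w - wdz1 g (w - h * I)‖ + ‖wdz1 (wdzbar1 W) w‖
            + ‖wdz1 (wdzbar1 W) (w - h * I)‖ :=
          (norm_add_le _ _).trans (add_le_add_left (norm_sub_le _ _) _)
        _ ≤ _ := by linarith
    have := norm_image_sub_le_of_norm_deriv_le_segment' (a := 0) (b := 2 * Real.pi)
      (f := fun h : ℝ => g (w - h * I) + h * fderiv ℝ g w I)
      (f' := fun h => fderiv ℝ g w I - fderiv ℝ g (w - h * I) I)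
      (C := (C₁ + 2 * N) * Real.exp (γ * w.re))
      (fun h _ => (((derI hgs w h hw0).add
        ((hasDerivAt_id h).ofReal_comp.mul_const _)).congr_deriv
          (by push_cast; ring)).hasDerivWithinAt)
      (fun h hh => hosc h (Ico_subset_Icc_self hh)) _ (right_mem_Icc.2 (by positivity))
    simp only [hgper, ofReal_zero, zero_mul, sub_zero, add_zero, add_sub_cancel_left] at this
    rw [norm_mul, Complex.norm_real, Real.norm_of_nonneg (by positivity), mul_comm] at this
    exact le_of_mul_le_mul_right this (by positivity)
  have hsnd : ∀ w : ℂ, w.re < -2 →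
      ‖wdz1 g w‖ ≤ (C₁ + 3 * N) * Real.exp (γ * w.re) := by
    intro w hw
    have hw0 : w.re < 0 := by linarith
    have e : wdz1 g w = -I * fderiv ℝ g w I + wdz1 (wdzbar1 W) w := by
      rw [fderiv_I_eq, hgF w hw0]
      linear_combination (wdz1 g w - wdz1 (wdzbar1 W) w) * I_mul_I
    rw [e]
    refine (norm_add_le _ _).trans ?_
    rw [norm_mul, norm_neg, norm_I, one_mul]
    linarith [hang w hw, hF w hw0]
  set K := C₁ + 4 * N with hK
  have hK0 : 0 ≤ K := by positivity
  set C₄ := K / γ + (C₁ + 2 * N) * (2 * Real.pi) with hC₄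
  have hC₄0 : 0 ≤ C₄ := by positivity
  have lineR : ∀ (w : ℂ) (s : ℝ), HasDerivAt (fun s : ℝ => w - s) (-1) s := fun w s => by
    simpa using (hasDerivAt_id s).ofReal_comp.const_sub w
  have derR : ∀ {f : ℂ → ℂ}, ContDiffOn ℝ (⊤ : ℕ∞) f {w | w.re < 0} → ∀ (w : ℂ) (s : ℝ),
      (w - s).re < 0 → HasDerivAt (fun s : ℝ => f (w - s)) (-fderiv ℝ f (w - s) 1) s := by
    intro f hf w s hw
    refine ((hf.diffAt hopen (z := w - s) hw).hasFDerivAt.comp_hasDerivAt s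
        (lineR w s)).congr_deriv ?_
    simp
  have hrad : ∀ w : ℂ, w.re < -2 → ∀ s : ℝ, 0 ≤ s →
      ‖g (w - s) - g w‖ ≤ K / γ * Real.exp (γ * w.re) := by
    intro w hw s hs
    have := image_norm_le_of_norm_deriv_right_le_deriv_boundary' (a := 0) (b := s)
      (f := fun s : ℝ => g (w - s) - g w) (f' := fun s => -fderiv ℝ g (w - s) 1)
      (B := fun s => K / γ * (Real.exp (γ * w.re) - Real.exp (γ * (w.re - s))))
      (B' := fun s => K * Real.exp (γ * (w.re - s)))
      (fun s hs => ((derR hgs w s (by simp; linarith [hs.1])).sub_const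
        _).continuousAt.continuousWithinAt)
      (fun s hs => ((derR hgs w s (by simp; linarith [hs.1])).sub_const _).hasDerivWithinAt)
      (by simp) (Continuous.continuousOn (by fun_prop))
      (fun s _ => by
        have h1 : HasDerivAt (fun s => γ * (w.re - s)) (-γ) s := by
          simpa using ((hasDerivAt_id s).const_sub w.re).const_mul γ
        refine (((h1.exp.const_sub _).const_mul (K / γ)).congr_deriv ?_).hasDerivWithinAt
        field_simp)
      (fun s hs => by
        have hws : (w - s).re = w.re - s := by simp
        have h2 : (w - s).re < -2 := by rw [hws]; linarith [hs.1]
        have h3 : (w - s).re < 0 := by linarith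
        rw [norm_neg, fderiv_one_eq, hgF _ h3]
        refine (norm_add_le _ _).trans ?_
        rw [← hws, hK]
        linarith [hsnd _ h2, hF _ h3]) (right_mem_Icc.2 hs)
    refine this.trans ?_
    have : 0 ≤ K / γ := by positivity
    gcongr
    exact sub_le_self _ (Real.exp_pos _).le
  have hdist : ∀ w : ℂ, w.re < -2 → ∀ s : ℝ, 0 ≤ s → ∀ h ∈ Icc (0 : ℝ) (2 * Real.pi),
      ‖g (w - s - h * I) - g w‖ ≤ C₄ * Real.exp (γ * w.re) := by
    intro w hw s hs h hh
    have hws : (w - s).re = w.re - s := by simp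
    have hexp : Real.exp (γ * (w.re - s)) ≤ Real.exp (γ * w.re) := by
      gcongr; linarith
    have h1 := norm_image_sub_le_of_norm_deriv_le_segment' (a := 0) (b := 2 * Real.pi)
      (f := fun h : ℝ => g (w - s - h * I)) (f' := fun h => -fderiv ℝ g (w - s - h * I) I)
      (C := (C₁ + 2 * N) * Real.exp (γ * w.re))
      (fun h _ => (derI hgs (w - s) h (by rw [hws]; linarith)).hasDerivWithinAt)
      (fun h _ => by
        rw [norm_neg]
        refine (hang _ (by rw [hre, hws]; linarith)).trans ?_
        rw [hre, hws]
        gcongr) h hh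
    simp only [ofReal_zero, zero_mul, sub_zero] at h1
    have h2 : (C₁ + 2 * N) * Real.exp (γ * w.re) * h
        ≤ (C₁ + 2 * N) * Real.exp (γ * w.re) * (2 * Real.pi) := by
      gcongr; exact hh.2
    calc _ = ‖(g (w - s - h * I) - g (w - s)) + (g (w - s) - g w)‖ := by congr 1; ring
      _ ≤ _ := norm_add_le _ _
      _ ≤ _ := by rw [hC₄]; linarith [hrad w hw s hs]
  have hfst : ∀ w : ℂ, w.re < -2 → ‖g w‖ ≤ C₄ * Real.exp (γ * w.re) := by
    intro w hw
    set m : ℝ → ℂ := fun s => ∫ h in (0 : ℝ)..2 * Real.pi, W (w - s - h * I) with hm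
    have hcont : ∀ {f : ℂ → ℂ}, ContinuousOn f {w | w.re < 0} →
        ContinuousOn (Function.uncurry fun (s h : ℝ) => f (w - s - h * I)) (Ioi (-1) ×ˢ univ) := by
      intro f hf
      refine hf.comp (f := fun x : ℝ × ℝ => w - x.1 - x.2 * I) (by fun_prop) ?_
      intro x hx
      have := mem_Ioi.1 hx.1
      simp only [mem_ofPred_eq, hre, sub_re, ofReal_re]
      linarith
    have hcont1 : ∀ {f : ℂ → ℂ}, ContinuousOn f {w | w.re < 0} → ∀ s : ℝ, 0 ≤ s →
        IntervalIntegrable (fun h : ℝ => f (w - s - h * I)) MeasureTheory.volume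
          0 (2 * Real.pi) := by
      intro f hf s hs
      refine ContinuousOn.intervalIntegrable ?_
      exact (hcont hf).comp (f := fun h : ℝ => (s, h)) (by fun_prop)
        fun h _ => ⟨mem_Ioi.2 (by linarith), mem_univ _⟩
    have hmM : ∀ s : ℝ, 0 ≤ s → ‖m s‖ ≤ M * (2 * Real.pi) := by
      intro s hs
      have := intervalIntegral.norm_integral_le_of_norm_le_const (a := 0) (b := 2 * Real.pi)
        (C := M) (f := fun h : ℝ => W (w - s - h * I))
        (fun h _ => hM _ (by rw [hre]; simp; linarith))
      rwa [sub_zero, abs_of_pos Real.two_pi_pos] at this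
    have hmd : ∀ s : ℝ, 0 ≤ s → HasDerivAt m
        (-(2 * ∫ h in (0 : ℝ)..2 * Real.pi, g (w - s - h * I))) s := by
      intro s hs
      have hws : (w - s).re < 0 := by simp; linarith
      have hW1 := contDiffOn_fderiv_apply hopen hW 1
      have hWI := contDiffOn_fderiv_apply hopen hW I
      have h1 := hasDerivAt_intervalIntegral_of_continuousOn (J := Ioi (-1)) isOpen_Ioi
        (f := fun s h => W (w - s - h * I)) (f' := fun s h => -fderiv ℝ W (w - s - h * I) 1)
        (by
          intro r hr h
          have hr := mem_Ioi.1 hr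
          have := derR hW (w - h * I) r (by simp; linarith)
          simpa only [sub_right_comm] using this)
        (hcont hW.continuousOn) (hcont (f := fun z => -fderiv ℝ W z 1) hW1.continuousOn.neg)
        0 (2 * Real.pi) (r := s) (mem_Ioi.2 (by linarith))
      refine h1.congr_deriv ?_
      have h2 := intervalIntegral.integral_eq_sub_of_hasDerivAt (a := 0) (b := 2 * Real.pi)
        (fun h _ => derI hW (w - s) h hws)
        (hcont1 (f := fun z => -fderiv ℝ W z I) hWI.continuousOn.neg s hs)
      have h3 : W (w - s - ((2 * Real.pi : ℝ) : ℂ) * I) = W (w - s) := by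
        rw [← hper (w - s - ((2 * Real.pi : ℝ) : ℂ) * I)]
        congr 1; push_cast; ring
      rw [h3] at h2
      simp only [ofReal_zero, zero_mul, sub_zero, sub_self] at h2
      have e : ∀ z, -fderiv ℝ W z 1 = (-2) * g z + I * -fderiv ℝ W z I := by
        intro z
        rw [fderiv_I_eq, fderiv_one_eq]
        linear_combination (wdz1 W z - wdzbar1 W z) * I_mul_I
      simp only [e]
      rw [intervalIntegral.integral_add
        ((hcont1 hgs.continuousOn s hs).const_mul (-2))
        ((hcont1 (f := fun z => -fderiv ℝ W z I) hWI.continuousOn.neg s hs).const_mul I),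
        intervalIntegral.integral_const_mul, intervalIntegral.integral_const_mul, h2]
      ring
    have hgrowth : ∀ S : ℝ, 0 < S →
        ‖g w‖ ≤ C₄ * Real.exp (γ * w.re) + M / S := by
      intro S hS
      have := norm_image_sub_le_of_norm_deriv_le_segment' (a := 0) (b := S)
        (f := fun s : ℝ => m s + s * (4 * Real.pi * g w))
        (f' := fun s => -(2 * ∫ h in (0 : ℝ)..2 * Real.pi, g (w - s - h * I))
          + 4 * Real.pi * g w)
        (C := 4 * Real.pi * (C₄ * Real.exp (γ * w.re)))
        (fun s hs => ((hmd s hs.1).add (((hasDerivAt_id s).ofReal_comp.mul_const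
          (4 * Real.pi * g w)).congr_deriv (by simp))).hasDerivWithinAt)
        (fun s hs => by
          have h1 : -(2 * ∫ h in (0 : ℝ)..2 * Real.pi, g (w - s - h * I)) + 4 * Real.pi * g w
              = -(2 * ∫ h in (0 : ℝ)..2 * Real.pi, (g (w - s - h * I) - g w)) := by
            rw [intervalIntegral.integral_sub (hcont1 hgs.continuousOn s hs.1)
              (continuous_const.intervalIntegrable _ _), intervalIntegral.integral_const]
            simp only [sub_zero, real_smul]
            push_cast; ring
          rw [h1, norm_neg, norm_mul, Complex.norm_ofNat]
          have h2 := intervalIntegral.norm_integral_le_of_norm_le_const (a := 0)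
            (b := 2 * Real.pi) (C := C₄ * Real.exp (γ * w.re))
            (f := fun h : ℝ => g (w - s - h * I) - g w) (fun h hh => by
              rw [uIoc_of_le Real.two_pi_pos.le] at hh
              exact hdist w hw s hs.1 h (Ioc_subset_Icc_self hh))
          rw [sub_zero, abs_of_pos Real.two_pi_pos] at h2
          linarith) S (right_mem_Icc.2 hS.le)
      simp only [ofReal_zero, zero_mul, add_zero, sub_zero] at this
      have h3 : ‖(S : ℂ) * (4 * Real.pi * g w)‖
          ≤ 4 * Real.pi * (C₄ * Real.exp (γ * w.re)) * S + M * (2 * Real.pi)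
            + M * (2 * Real.pi) := by
        calc _ = ‖(m S + S * (4 * Real.pi * g w) - m 0) - m S + m 0‖ := by congr 1; ring
          _ ≤ _ := (norm_add_le _ _).trans (add_le_add_left (norm_sub_le _ _) _)
          _ ≤ _ := by linarith [hmM S hS.le, hmM 0 le_rfl]
      have h4 : ‖(S : ℂ) * (4 * Real.pi * g w)‖ = 4 * Real.pi * S * ‖g w‖ := by
        simp [abs_of_pos hS, abs_of_pos hpi]; ring
      rw [h4] at h3
      have h5 : 4 * Real.pi * S * ‖g w‖
          ≤ 4 * Real.pi * S * (C₄ * Real.exp (γ * w.re) + M / S) := by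
        refine h3.trans_eq ?_
        field_simp
        ring
      exact le_of_mul_le_mul_left h5 (by positivity)
    have hlim : Tendsto (fun S : ℝ => C₄ * Real.exp (γ * w.re) + M / S) atTop
        (𝓝 (C₄ * Real.exp (γ * w.re) + 0)) :=
      tendsto_const_nhds.add (tendsto_const_nhds.div_atTop tendsto_id)
    rw [add_zero] at hlim
    exact ge_of_tendsto hlim ((eventually_gt_atTop 0).mono hgrowth)
  refine ⟨C₄ + (C₁ + 3 * N), by positivity, fun w hw => ⟨?_, ?_⟩⟩
  · refine (hfst w hw).trans ?_
    gcongr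
    linarith
  · refine (hsnd w hw).trans ?_
    exact mul_le_mul_of_nonneg_right (le_add_of_nonneg_left hC₄0) (Real.exp_pos _).le

/-- `f` is real differentiable at `z` with `∂f/∂ζ = a` and `∂f/∂ζ̄ = b`. -/
def HasWirtingerAt (f : ℂ → ℂ) (a b z : ℂ) : Prop :=
  ∃ L : ℂ →L[ℝ] ℂ, HasFDerivAt f L z ∧ ∀ h, L h = a * h + b * (starRingEnd ℂ) h

lemma HasWirtingerAt.wdz1_eq {f : ℂ → ℂ} {a b z : ℂ} (hf : HasWirtingerAt f a b z) :
    wdz1 f z = a :=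
  hf.choose_spec.1.wdz1_eq hf.choose_spec.2

lemma HasWirtingerAt.wdzbar1_eq {f : ℂ → ℂ} {a b z : ℂ} (hf : HasWirtingerAt f a b z) :
    wdzbar1 f z = b :=
  hf.choose_spec.1.wdzbar1_eq hf.choose_spec.2

lemma DifferentiableAt.hasWirtingerAt {f : ℂ → ℂ} {z : ℂ} (hf : DifferentiableAt ℝ f z) :
    HasWirtingerAt f (wdz1 f z) (wdzbar1 f z) z :=
  ⟨_, hf.hasFDerivAt, fderiv_apply_eq_wirtinger f z⟩

lemma HasDerivAt.hasWirtingerAt {f : ℂ → ℂ} {f' z : ℂ} (hf : HasDerivAt f f' z) :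
    HasWirtingerAt f f' 0 z :=
  ⟨_, hf.complexToReal_fderiv, fun h => by simp⟩

lemma HasWirtingerAt.conj {f : ℂ → ℂ} {a b z : ℂ} (hf : HasWirtingerAt f a b z) :
    HasWirtingerAt (fun w => (starRingEnd ℂ) (f w)) ((starRingEnd ℂ) b) ((starRingEnd ℂ) a) z := by
  obtain ⟨L, hL, h⟩ := hf
  refine ⟨_, conjCLE.toContinuousLinearMap.hasFDerivAt.comp z hL, fun k => ?_⟩
  simp [h]
  ring

lemma HasWirtingerAt.mul {f g : ℂ → ℂ} {a b c d z : ℂ} (hf : HasWirtingerAt f a b z)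
    (hg : HasWirtingerAt g c d z) :
    HasWirtingerAt (fun w => f w * g w) (a * g z + f z * c) (b * g z + f z * d) z := by
  obtain ⟨L, hL, h⟩ := hf
  obtain ⟨K, hK, k⟩ := hg
  refine ⟨_, hL.mul hK, fun x => ?_⟩
  simp [h, k]
  ring

lemma HasWirtingerAt.sub {f g : ℂ → ℂ} {a b c d z : ℂ} (hf : HasWirtingerAt f a b z)
    (hg : HasWirtingerAt g c d z) :
    HasWirtingerAt (fun w => f w - g w) (a - c) (b - d) z := by
  obtain ⟨L, hL, h⟩ := hf
  obtain ⟨K, hK, k⟩ := hg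
  refine ⟨_, hL.sub hK, fun x => ?_⟩
  simp [h, k]
  ring

lemma HasWirtingerAt.const_mul {f : ℂ → ℂ} {a b z : ℂ} (c : ℂ) (hf : HasWirtingerAt f a b z) :
    HasWirtingerAt (fun w => c * f w) (c * a) (c * b) z := by
  obtain ⟨L, hL, h⟩ := hf
  refine ⟨_, hL.const_mul c, fun x => ?_⟩
  simp [h]
  ring

lemma HasWirtingerAt.comp_exp {f : ℂ → ℂ} {a b w : ℂ} (hf : HasWirtingerAt f a b (cexp w)) :
    HasWirtingerAt (fun w => f (cexp w)) (a * cexp w) (b * (starRingEnd ℂ) (cexp w)) w := by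
  obtain ⟨L, hL, h⟩ := hf
  refine ⟨_, hL.comp w (Complex.hasDerivAt_exp w).complexToReal_fderiv, fun x => ?_⟩
  simp [h]
  ring

lemma hasWirtingerAt_exp_re (β : ℝ) (w : ℂ) :
    HasWirtingerAt (fun w => ((Real.exp (2 * β * w.re) : ℝ) : ℂ))
      (β * (Real.exp (2 * β * w.re) : ℝ)) (β * (Real.exp (2 * β * w.re) : ℝ)) w := by
  refine ⟨_, ofRealCLM.hasFDerivAt.comp w ((reCLM.hasFDerivAt (x := w)).const_mul (2 * β)).exp,
    fun h => ?_⟩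
  have := Complex.add_conj h
  simp only [ContinuousLinearMap.coe_comp, Function.comp_apply, ofRealCLM_apply, reCLM_apply,
    smul_apply, smul_eq_mul]
  rw [← mul_add, this]
  push_cast
  ring

lemma norm_exp_sub_exp_le {x y : ℂ} (h : ‖x - y‖ ≤ 1) :
    ‖cexp x - cexp y‖ ≤ 2 * Real.exp y.re * ‖x - y‖ := by
  have e : cexp x - cexp y = cexp y * (cexp (x - y) - 1) := by
    rw [mul_sub, ← Complex.exp_add]; simp
  rw [e, norm_mul, Complex.norm_exp]
  linarith [mul_le_mul_of_nonneg_left (Complex.norm_exp_sub_one_le h) (Real.exp_pos y.re).le]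

/-- The exponentially weighted Hölder function obtained from the right-hand side of the equation
in logarithmic coordinates. -/
lemma norm_weighted_sub_le {α β Cf : ℝ} (hα : α ∈ Ioo (0 : ℝ) 1) (hβ : β ∈ Ioo (0 : ℝ) (1 / 2))
    {ft F : ℂ → ℂ} (hCf : 0 ≤ Cf)
    (hft : ∀ x ∈ ball (0 : ℂ) 1, ∀ y ∈ ball (0 : ℂ) 1, ‖ft x - ft y‖ ≤ Cf * ‖x - y‖ ^ α)
    (hF : ∀ w : ℂ, w.re < 0 → F w = (Real.exp (2 * β * w.re) : ℝ) *
      (ft (cexp ((β * w.re : ℝ) + w.im * I)) - ft 0)) :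
    (∀ w : ℂ, w.re < 0 → ‖F w‖ ≤ 8 * Cf * Real.exp ((2 * β + α * β) * w.re)) ∧
    ∀ w z : ℂ, w.re < -2 → ‖z - w‖ ≤ 1 →
      ‖F z - F w‖ ≤ 8 * Cf * Real.exp ((2 * β + α * β) * w.re) * ‖z - w‖ ^ α := by
  obtain ⟨hα0, hα1⟩ := hα
  obtain ⟨hβ0, hβ1⟩ := hβ
  set q : ℂ → ℂ := fun w => (β * w.re : ℝ) + w.im * I with hq
  have hqre : ∀ w, (q w).re = β * w.re := fun w => by simp [hq]
  have hp : ∀ w, ‖cexp (q w)‖ = Real.exp (β * w.re) := fun w => by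
    rw [Complex.norm_exp, hqre]
  have hmem : ∀ w : ℂ, w.re < 0 → cexp (q w) ∈ ball (0 : ℂ) 1 := fun w hw => by
    rw [mem_ball_zero_iff, hp, Real.exp_lt_one_iff]
    exact mul_neg_of_pos_of_neg hβ0 hw
  have h0 : (0 : ℂ) ∈ ball (0 : ℂ) 1 := by simp
  have hb : ∀ w : ℂ, w.re < 0 → ‖ft (cexp (q w)) - ft 0‖ ≤ Cf * Real.exp (α * β * w.re) := by
    intro w hw
    refine (hft _ (hmem w hw) 0 h0).trans_eq ?_
    rw [sub_zero, hp, ← Real.exp_mul]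
    ring_nf
  have hsplit : ∀ w : ℂ, Real.exp ((2 * β + α * β) * w.re)
      = Real.exp (2 * β * w.re) * Real.exp (α * β * w.re) := fun w => by
    rw [← Real.exp_add]; ring_nf
  refine ⟨fun w hw => ?_, fun w z hw hzw => ?_⟩
  · rw [hF w hw, norm_mul, Complex.norm_real, Real.norm_of_nonneg (Real.exp_pos _).le, hsplit]
    have := mul_le_mul_of_nonneg_left (hb w hw) (Real.exp_pos (2 * β * w.re)).le
    have h2 : 0 ≤ Real.exp (2 * β * w.re) * (Cf * Real.exp (α * β * w.re)) := by positivity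
    linarith
  · have hw0 : w.re < 0 := by linarith
    have hre : |z.re - w.re| ≤ ‖z - w‖ := by simpa using abs_re_le_norm (z - w)
    have hz0 : z.re < 0 := by linarith [(abs_le.1 (hre.trans hzw)).2]
    set d := ‖z - w‖ with hd
    have hd0 : 0 ≤ d := norm_nonneg _
    set E := Real.exp (2 * β * w.re) with hE
    set P := Real.exp (α * β * w.re) with hP
    have hE0 : 0 < E := Real.exp_pos _
    have hP0 : 0 < P := Real.exp_pos _
    have hEd : |Real.exp (2 * β * z.re) - E| ≤ 2 * E * d := by
      have h1 : |2 * β * z.re - 2 * β * w.re| ≤ d := by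
        rw [← mul_sub, abs_mul, abs_of_pos (by positivity)]
        nlinarith [abs_nonneg (z.re - w.re)]
      have h2 : ‖((2 * β * z.re : ℝ) : ℂ) - ((2 * β * w.re : ℝ) : ℂ)‖ ≤ d := by
        rwa [← ofReal_sub, Complex.norm_real]
      have h3 := norm_exp_sub_exp_le (h2.trans hzw)
      rw [← ofReal_exp, ← ofReal_exp, ofReal_re, ← ofReal_sub, Complex.norm_real,
        Real.norm_eq_abs] at h3
      exact h3.trans (by gcongr)
    have hEz : Real.exp (2 * β * z.re) ≤ 3 * E := by
      nlinarith [(abs_le.1 hEd).2]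
    have hpd : ‖cexp (q z) - cexp (q w)‖ ≤ 2 * Real.exp (β * w.re) * d := by
      have h1 : ‖q z - q w‖ ≤ d := by
        have e : q z - q w = ((β * (z.re - w.re) : ℝ) : ℂ) + ((z.im - w.im : ℝ) : ℂ) * I := by
          simp only [hq]; push_cast; ring
        rw [e, Complex.norm_add_mul_I, hd, Complex.norm_eq_sqrt_sq_add_sq, sub_re, sub_im]
        refine Real.sqrt_le_sqrt (add_le_add_left ?_ _)
        rw [mul_pow]
        exact mul_le_of_le_one_left (sq_nonneg _) (by nlinarith)
      refine (norm_exp_sub_exp_le (h1.trans hzw)).trans ?_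
      rw [hqre]
      gcongr
    have hftd : ‖ft (cexp (q z)) - ft (cexp (q w))‖ ≤ 2 * Cf * P * d ^ α := by
      refine (hft _ (hmem z hz0) _ (hmem w hw0)).trans ?_
      have h1 := Real.rpow_le_rpow (norm_nonneg _) hpd hα0.le
      rw [Real.mul_rpow (by positivity) hd0, Real.mul_rpow (by norm_num) (by positivity),
        ← Real.exp_mul] at h1
      have h2 : (2 : ℝ) ^ α ≤ 2 := by
        simpa using Real.rpow_le_rpow_of_exponent_le (by norm_num : (1 : ℝ) ≤ 2) hα1.le
      have h3 : Real.exp (β * w.re * α) = P := by rw [hP]; ring_nf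
      rw [h3] at h1
      calc _ ≤ Cf * ((2 : ℝ) ^ α * P * d ^ α) := by gcongr
        _ ≤ Cf * (2 * P * d ^ α) := by gcongr
        _ = _ := by ring
    have hdα : d ≤ d ^ α := Real.self_le_rpow_of_le_one hd0 hzw hα1.le
    have e : F z - F w = (Real.exp (2 * β * z.re) : ℝ) * (ft (cexp (q z)) - ft (cexp (q w)))
        + ((Real.exp (2 * β * z.re) - E : ℝ) : ℂ) * (ft (cexp (q w)) - ft 0) := by
      rw [hF z hz0, hF w hw0, ofReal_sub]; ring
    rw [e, hsplit]
    refine (norm_add_le _ _).trans ?_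
    rw [norm_mul, norm_mul, Complex.norm_real, Complex.norm_real,
      Real.norm_of_nonneg (Real.exp_pos _).le, Real.norm_eq_abs]
    calc _ ≤ 3 * E * (2 * Cf * P * d ^ α) + 2 * E * d * (Cf * P) := by
          gcongr
          exact hb w hw0
      _ ≤ 3 * E * (2 * Cf * P * d ^ α) + 2 * E * d ^ α * (Cf * P) := by gcongr
      _ = _ := by ring

end

/-- if |ζ|^{2−2β}·∂²v/∂ζ∂ζ̄ = f̃(|ζ|^{β−1}ζ) with f̃ α-Hölder continuous
and v bounded and smooth on the punctured disk, then
|ζ|^{2−2β}·(∂²v/∂ζ² + ((1−β)/ζ)·∂v/∂ζ) = O(|ζ|^{αβ}). -/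
theorem auxiliary_result
    (α β : ℝ) (hα : α ∈ Set.Ioo (0:ℝ) 1) (hβ : β ∈ Set.Ioo (0:ℝ) (1/2))
    (hαβ : α * β < 1 - 2*β)
    (ft : ℂ → ℂ) (Cf : ℝ)
    (hft : ∀ x ∈ Metric.ball (0:ℂ) 1, ∀ y ∈ Metric.ball (0:ℂ) 1,
      ‖ft x - ft y‖ ≤ Cf * ‖x - y‖ ^ α)
    (v : ℂ → ℂ)
    (hv : ContDiffOn ℝ (⊤ : ℕ∞) v (Metric.ball (0:ℂ) 1 \ {0}))
    (M : ℝ) (hbd : ∀ ζ ∈ Metric.ball (0:ℂ) 1 \ {0}, ‖v ζ‖ ≤ M)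
    (heq : ∀ ζ ∈ Metric.ball (0:ℂ) 1 \ {0},
      ((‖ζ‖ ^ (2 - 2*β) : ℝ) : ℂ) * wdz1 (wdzbar1 v) ζ
        = ft (((‖ζ‖ ^ (β - 1) : ℝ) : ℂ) * ζ)) :
    ∃ C > (0:ℝ), ∃ r ∈ Set.Ioo (0:ℝ) 1, ∀ ζ : ℂ, 0 < ‖ζ‖ → ‖ζ‖ < r →
      ‖((‖ζ‖ ^ (2 - 2*β) : ℝ) : ℂ) *
        (wdz1 (wdz1 v) ζ + (((1 - β : ℝ) : ℂ) / ζ) * wdz1 v ζ)‖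
      ≤ C * ‖ζ‖ ^ (α * β) := by
  have hβ0 : (β : ℂ) ≠ 0 := ofReal_ne_zero.2 hβ.1.ne'
  have hβpos := hβ.1
  have hβlt := hβ.2
  have hαpos := hα.1
  have hCf : 0 ≤ Cf := by
    have := (norm_nonneg _).trans (hft 0 (by simp) (1 / 2) (by simp; norm_num))
    exact nonneg_of_mul_nonneg_left this (Real.rpow_pos_of_pos (by norm_num) _)
  have hU : IsOpen (ball (0 : ℂ) 1 \ {0}) := isOpen_ball.sdiff isClosed_singleton
  have hH := isOpen_re_neg
  have hmem : ∀ {w : ℂ}, w.re < 0 → cexp w ∈ ball (0 : ℂ) 1 \ {0} := fun {w} hw =>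
    ⟨by rwa [mem_ball_zero_iff, Complex.norm_exp, Real.exp_lt_one_iff], Complex.exp_ne_zero w⟩
  set E : ℂ → ℂ := fun w => ((Real.exp (2 * β * w.re) : ℝ) : ℂ) with hE
  have hEw : ∀ w, HasWirtingerAt E (β * E w) (β * E w) w := hasWirtingerAt_exp_re β
  set c : ℂ := ft 0 / β ^ 2 with hc
  set W : ℂ → ℂ := fun w => v (cexp w) - c * E w with hW
  have hW1 : ∀ w : ℂ, w.re < 0 → HasWirtingerAt W (wdz1 v (cexp w) * cexp w - c * (β * E w))
      (wdzbar1 v (cexp w) * (starRingEnd ℂ) (cexp w) - c * (β * E w)) w := fun w hw =>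
    (hv.diffAt hU (hmem hw)).hasWirtingerAt.comp_exp.sub ((hEw w).const_mul c)
  have hdd : ∀ w : ℂ, w.re < 0 → wdz1 (wdz1 W) w
      = wdz1 (wdz1 v) (cexp w) * cexp w ^ 2 + wdz1 v (cexp w) * cexp w - c * β ^ 2 * E w := by
    intro w hw
    rw [wdz1_congr (Filter.eventually_of_mem (hH.mem_nhds hw) fun y hy => (hW1 y hy).wdz1_eq),
      (((((contDiffOn_wdz1 hU hv).diffAt hU (hmem hw)).hasWirtingerAt.comp_exp).mul
        (Complex.hasDerivAt_exp w).hasWirtingerAt).sub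
          (((hEw w).const_mul β).const_mul c)).wdz1_eq]
    ring
  have hmix : ∀ w : ℂ, w.re < 0 → wdz1 (wdzbar1 W) w = E w *
      (ft (cexp ((β * w.re : ℝ) + w.im * I)) - ft 0) := by
    intro w hw
    rw [wdz1_congr (Filter.eventually_of_mem (hH.mem_nhds hw) fun y hy => (hW1 y hy).wdzbar1_eq),
      (((((contDiffOn_wdzbar1 hU hv).diffAt hU (hmem hw)).hasWirtingerAt.comp_exp).mul
        (Complex.hasDerivAt_exp w).hasWirtingerAt.conj).sub
          (((hEw w).const_mul β).const_mul c)).wdz1_eq]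
    have h1 := heq _ (hmem hw)
    have h2 : ((‖cexp w‖ ^ (β - 1) : ℝ) : ℂ) * cexp w
        = cexp ((β * w.re : ℝ) + w.im * I) := by
      rw [Complex.norm_exp, ← Real.exp_mul, ofReal_exp, ← Complex.exp_add]
      congr 1
      apply Complex.ext <;> simp
      ring
    have h3 : cexp w * (starRingEnd ℂ) (cexp w) = E w * ((‖cexp w‖ ^ (2 - 2 * β) : ℝ) : ℂ) := by
      rw [Complex.mul_conj, normSq_eq_norm_sq, Complex.norm_exp, ← Real.exp_mul, hE, ← ofReal_mul,
        ← Real.exp_add, ← Real.exp_nat_mul]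
      congr 2
      push_cast
      ring
    rw [h2] at h1
    have h4 : c * β ^ 2 = ft 0 := by rw [hc]; field_simp
    rw [← h1]
    simp only [map_zero, mul_zero, add_zero]
    linear_combination wdz1 (wdzbar1 v) (cexp w) * h3 - E w * h4
  have hEs : ContDiff ℝ (⊤ : ℕ∞) E :=
    ofRealCLM.contDiff.comp (Real.contDiff_exp.comp (contDiff_const.mul reCLM.contDiff))
  have hWs : ContDiffOn ℝ (⊤ : ℕ∞) W {w | w.re < 0} :=
    (hv.comp (Complex.contDiff_exp (𝕜 := ℝ)).contDiffOn fun w hw => hmem hw).sub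
      (contDiff_const.mul hEs).contDiffOn
  have hWper : ∀ w, W (w + 2 * Real.pi * I) = W w := fun w => by
    simp [hW, hE, Complex.exp_periodic w]
  have hWM : ∀ w : ℂ, w.re < 0 → ‖W w‖ ≤ M + ‖c‖ := by
    intro w hw
    refine (norm_sub_le _ _).trans (add_le_add (hbd _ (hmem hw)) ?_)
    rw [norm_mul]
    refine mul_le_of_le_one_right (norm_nonneg _) ?_
    rw [hE, Complex.norm_real, Real.norm_of_nonneg (Real.exp_pos _).le, Real.exp_le_one_iff]
    nlinarith
  obtain ⟨hF, hFH⟩ := norm_weighted_sub_le hα hβ hCf hft hmix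
  obtain ⟨C, hC0, hC⟩ := exists_norm_wdz1_le (γ := 2 * β + α * β) (by positivity)
    (by linarith) hα.1 (by positivity) hWs hWper hWM hF hFH
  refine ⟨C * 2 + 1, by positivity, Real.exp (-2), ⟨Real.exp_pos _, by simp⟩, fun ζ h0 hr => ?_⟩
  have hζ0 : ζ ≠ 0 := norm_pos_iff.1 h0
  have hexp : cexp (Complex.log ζ) = ζ := Complex.exp_log hζ0
  have hlog : (Complex.log ζ).re < -2 := by
    rw [Complex.log_re]; exact (Real.log_lt_iff_lt_exp h0).2 hr
  have hlog0 : (Complex.log ζ).re < 0 := by linarith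
  obtain ⟨hC1, hC2⟩ := hC _ hlog
  have hpow : Real.exp ((2 * β + α * β) * (Complex.log ζ).re) = ‖ζ‖ ^ (2 * β + α * β) := by
    rw [Complex.log_re, Real.rpow_def_of_pos h0, mul_comm]
  rw [hpow] at hC1 hC2
  have key : wdz1 (wdz1 v) ζ + (((1 - β : ℝ) : ℂ) / ζ) * wdz1 v ζ
      = (wdz1 (wdz1 W) (Complex.log ζ) - β * wdz1 W (Complex.log ζ)) / ζ ^ 2 := by
    rw [hdd _ hlog0, (hW1 _ hlog0).wdz1_eq, hexp]
    field_simp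
    push_cast
    ring
  have hY : ‖wdz1 (wdz1 W) (Complex.log ζ) - β * wdz1 W (Complex.log ζ)‖
      ≤ (C * 2 + 1) * ‖ζ‖ ^ (2 * β + α * β) := by
    refine (norm_sub_le _ _).trans ?_
    rw [norm_mul, Complex.norm_real, Real.norm_of_nonneg hβpos.le]
    have h1 : β * ‖wdz1 W (Complex.log ζ)‖ ≤ ‖wdz1 W (Complex.log ζ)‖ :=
      mul_le_of_le_one_left (norm_nonneg _) (by linarith)
    have h2 : 0 ≤ ‖ζ‖ ^ (2 * β + α * β) := by positivity
    linarith
  rw [key, norm_mul, norm_div, norm_pow, Complex.norm_real,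
    Real.norm_of_nonneg (Real.rpow_nonneg h0.le _)]
  have hsplit : ‖ζ‖ ^ (2 - 2 * β) * ‖ζ‖ ^ (2 * β + α * β) = ‖ζ‖ ^ 2 * ‖ζ‖ ^ (α * β) := by
    rw [← Real.rpow_natCast, ← Real.rpow_add h0, ← Real.rpow_add h0]
    congr 1; push_cast; ring
  rw [← mul_div_assoc, div_le_iff₀ (by positivity)]
  calc _ ≤ ‖ζ‖ ^ (2 - 2 * β) * ((C * 2 + 1) * ‖ζ‖ ^ (2 * β + α * β)) := by gcongr
    _ = _ := by linear_combination (C * 2 + 1) * hsplit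
end
end
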